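/- Let f : H → L¹ be a Lipschitz map with respect to the Carnot–Carathéodory distance d. For x ∈ H and λ > 0 define ρ_{x,λ}(z₁,z₂) := (1/λ)·‖f(x·s_λ(z₁)) − f(x·s_λ(z₂))‖₁. Then for Lebesgue-almost every x ∈ H there exists a seminorm ‖·‖ₓ on ℝ² such that ρ_{x,λ}(z₁,z₂) → ‖π(z₁) − π(z₂)‖ₓ as λ → 0, uniformly on compact subsets of H × H. In particular the limiting pseudo-distance vanishes on each fiber of π, and hence f is not bi-Lipschitz on any neighborhood of x. -/

import Mathlib

open MeasureTheory Set Topology Filter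

noncomputable section

/-- The Heisenberg group as a set: `ℝ³`. -/
abbrev Heis : Type := ℝ × ℝ × ℝ

/-- The Heisenberg group multiplication
`(a,b,c)·(a',b',c') = (a+a', b+b', c+c'+a·b')`. -/
def hMul (x y : Heis) : Heis :=
  (x.1 + y.1, x.2.1 + y.2.1, x.2.2 + y.2.2 + x.1 * y.2.1)

/-- The abelianization homomorphism `π : H → ℝ²`, `π(a,b,c) = (a,b)`. -/
def hPi (x : Heis) : ℝ × ℝ := (x.1, x.2.1)

/-- A Lipschitz path `c : [0,1] → H` is horizontal with (a.e.) component derivatives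
`v₁, v₂` if `c₁' = v₁`, `c₂' = v₂` and `c₃'(t) = c₁(t)·c₂'(t)` hold almost everywhere
on `[0,1]`. -/
def IsHorizPath (c : ℝ → Heis) (v₁ v₂ : ℝ → ℝ) : Prop :=
  ∀ᵐ t ∂(volume : Measure ℝ), t ∈ Icc (0 : ℝ) 1 →
    HasDerivAt (fun u => (c u).1) (v₁ t) t ∧
    HasDerivAt (fun u => (c u).2.1) (v₂ t) t ∧
    HasDerivAt (fun u => (c u).2.2) ((c t).1 * v₂ t) t

/-- The length `∫₀¹ √(c₁'(t)² + c₂'(t)²) dt` of a horizontal path. -/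
def pathLen (v₁ v₂ : ℝ → ℝ) : ℝ :=
  ∫ t in (0 : ℝ)..1, Real.sqrt (v₁ t ^ 2 + v₂ t ^ 2)

/-- The Carnot–Carathéodory distance on the Heisenberg group: the infimum of lengths
of Lipschitz horizontal paths joining the two points. -/
def ccDist (x y : Heis) : ℝ :=
  sInf { l : ℝ | ∃ c : ℝ → Heis, ∃ v₁ v₂ : ℝ → ℝ,
    (∃ K : NNReal, LipschitzOnWith K c (Icc 0 1)) ∧
    IsHorizPath c v₁ v₂ ∧
    IntervalIntegrable (fun t => Real.sqrt (v₁ t ^ 2 + v₂ t ^ 2)) volume 0 1 ∧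
    c 0 = x ∧ c 1 = y ∧ l = pathLen v₁ v₂ }

/-- The dilation `s_λ(a,b,c) = (λa, λb, λ²c)`. -/
def dil (lam : ℝ) (z : Heis) : Heis := (lam * z.1, lam * z.2.1, lam ^ 2 * z.2.2)

/-- The one-parameter subgroup point `exp v` over `v ∈ ℝ²`. -/
def hExp (v : ℝ × ℝ) : Heis := (v.1, v.2, v.1 * v.2 / 2)

/-- The homogeneous quasi-norm distance on the Heisenberg group. -/
def hDist (x y : Heis) : ℝ :=
  max (max |y.1 - x.1| |y.2.1 - x.2.1|)
    (max (√|y.2.2 - x.2.2 - x.1 * (y.2.1 - x.2.1)|)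
      (√|y.2.2 - x.2.2 - y.1 * (y.2.1 - x.2.1)|))

lemma hDist_le_iff {x y : Heis} {r : ℝ} (hr : 0 ≤ r) :
    hDist x y ≤ r ↔ |y.1 - x.1| ≤ r ∧ |y.2.1 - x.2.1| ≤ r ∧
      |y.2.2 - x.2.2 - x.1 * (y.2.1 - x.2.1)| ≤ r ^ 2 ∧
      |y.2.2 - x.2.2 - y.1 * (y.2.1 - x.2.1)| ≤ r ^ 2 := by
  simp only [hDist, max_le_iff, Real.sqrt_le_left hr, and_assoc]

lemma hDist_nonneg (x y : Heis) : 0 ≤ hDist x y :=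
  (abs_nonneg _).trans ((le_max_left _ _).trans (le_max_left _ _))

lemma hDist_bounds (x y : Heis) :
    |y.1 - x.1| ≤ hDist x y ∧ |y.2.1 - x.2.1| ≤ hDist x y ∧
      |y.2.2 - x.2.2 - x.1 * (y.2.1 - x.2.1)| ≤ hDist x y ^ 2 ∧
      |y.2.2 - x.2.2 - y.1 * (y.2.1 - x.2.1)| ≤ hDist x y ^ 2 :=
  (hDist_le_iff (hDist_nonneg x y)).1 le_rfl

lemma hDist_self (x : Heis) : hDist x x = 0 := by simp [hDist]

lemma hDist_comm (x y : Heis) : hDist x y = hDist y x := by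
  have key : ∀ x y : Heis, hDist x y ≤ hDist y x := fun x y => by
    obtain ⟨h1, h2, h3, h4⟩ := hDist_bounds y x
    refine (hDist_le_iff (hDist_nonneg _ _)).2 ⟨by rwa [abs_sub_comm], by rwa [abs_sub_comm], ?_, ?_⟩
    · rw [← abs_neg]; convert h4 using 2; ring
    · rw [← abs_neg]; convert h3 using 2; ring
  exact le_antisymm (key _ _) (key _ _)

lemma hDist_triangle (x y z : Heis) : hDist x z ≤ hDist x y + hDist y z := by
  obtain ⟨a1, a2, a3, a4⟩ := hDist_bounds x y
  obtain ⟨b1, b2, b3, b4⟩ := hDist_bounds y z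
  have hr := hDist_nonneg x y
  have hs := hDist_nonneg y z
  set r := hDist x y
  set s := hDist y z
  refine (hDist_le_iff (by positivity)).2 ⟨?_, ?_, ?_, ?_⟩
  · rw [show z.1 - x.1 = (y.1 - x.1) + (z.1 - y.1) by ring]
    exact (abs_add_le _ _).trans (by linarith)
  · rw [show z.2.1 - x.2.1 = (y.2.1 - x.2.1) + (z.2.1 - y.2.1) by ring]
    exact (abs_add_le _ _).trans (by linarith)
  · have h : |(y.1 - x.1) * (z.2.1 - y.2.1)| ≤ r * s := by
      rw [abs_mul]; gcongr
    rw [show z.2.2 - x.2.2 - x.1 * (z.2.1 - x.2.1)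
      = (z.2.2 - y.2.2 - y.1 * (z.2.1 - y.2.1)) + (y.2.2 - x.2.2 - x.1 * (y.2.1 - x.2.1))
        + (y.1 - x.1) * (z.2.1 - y.2.1) by ring]
    refine (abs_add_three _ _ _).trans ?_
    nlinarith
  · have h : |(z.1 - y.1) * (y.2.1 - x.2.1)| ≤ s * r := by
      rw [abs_mul]; gcongr
    rw [← abs_neg] at h
    rw [show z.2.2 - x.2.2 - z.1 * (z.2.1 - x.2.1)
      = (z.2.2 - y.2.2 - z.1 * (z.2.1 - y.2.1)) + (y.2.2 - x.2.2 - y.1 * (y.2.1 - x.2.1))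
        + -((z.1 - y.1) * (y.2.1 - x.2.1)) by ring]
    refine (abs_add_three _ _ _).trans ?_
    nlinarith

lemma eq_of_hDist_eq_zero {x y : Heis} (h : hDist x y = 0) : x = y := by
  obtain ⟨a1, a2, a3, -⟩ := hDist_bounds x y
  rw [h] at a1 a2 a3
  have e1 : y.1 - x.1 = 0 := abs_nonpos_iff.1 a1
  have e2 : y.2.1 - x.2.1 = 0 := abs_nonpos_iff.1 a2
  have e3 := abs_nonpos_iff.1 (a3.trans (by norm_num))
  rw [e2] at e3
  ext <;> linarith

lemma continuous_hDist : Continuous fun p : Heis × Heis => hDist p.1 p.2 := by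
  unfold hDist; fun_prop

lemma hDist_hMul_left (g x y : Heis) : hDist (hMul g x) (hMul g y) = hDist x y := by
  simp only [hDist, hMul]
  congr 2
  · congr 1; ring
  · congr 1; ring
  · congr 2; ring
  · congr 2; ring

lemma hDist_dil (l : ℝ) (x y : Heis) : hDist (dil l x) (dil l y) = |l| * hDist x y := by
  have h : ∀ t : ℝ, √|l ^ 2 * t| = |l| * √|t| := fun t => by
    rw [abs_mul, Real.sqrt_mul (abs_nonneg _), abs_of_nonneg (sq_nonneg l), Real.sqrt_sq_eq_abs]
  simp only [hDist, dil]
  rw [mul_max_of_nonneg _ _ (abs_nonneg l), mul_max_of_nonneg _ _ (abs_nonneg l),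
    mul_max_of_nonneg _ _ (abs_nonneg l), ← h, ← h, ← abs_mul, ← abs_mul]
  congr 2
  · congr 1; ring
  · congr 1; ring
  · congr 2; ring
  · congr 2; ring

lemma hMul_assoc (x y z : Heis) : hMul (hMul x y) z = hMul x (hMul y z) := by
  simp only [hMul, Prod.mk.injEq]; refine ⟨by ring, by ring, by ring⟩

lemma dil_hMul (l : ℝ) (x y : Heis) : dil l (hMul x y) = hMul (dil l x) (dil l y) := by
  simp only [hMul, dil, Prod.mk.injEq]; refine ⟨by ring, by ring, by ring⟩

lemma dil_hExp (l : ℝ) (v : ℝ × ℝ) : dil l (hExp v) = hExp (l • v) := by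
  simp only [hExp, dil, Prod.smul_fst, Prod.smul_snd, smul_eq_mul, Prod.mk.injEq, true_and]
  ring

lemma hExp_add_smul (s t : ℝ) (v : ℝ × ℝ) :
    hMul (hExp (s • v)) (hExp (t • v)) = hExp ((s + t) • v) := by
  simp only [hExp, hMul, Prod.smul_fst, Prod.smul_snd, smul_eq_mul, Prod.mk.injEq]
  refine ⟨by ring, by ring, by ring⟩

lemma hDist_hMul_hMul_right (x y z : Heis) : hDist x (hMul x y) = hDist z (hMul z y) := by
  rw [← hDist_hMul_left z, ← hDist_hMul_left x z]
  simp only [hDist, hMul]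
  congr 2
  · congr 1; ring
  · congr 1; ring
  · congr 2; ring
  · congr 2; ring

/-- The quasi-norm of `exp v` measured from any base point. -/
lemma hDist_hMul_hExp_smul (x : Heis) (s : ℝ) (v : ℝ × ℝ) :
    hDist x (hMul x (hExp (s • v))) = |s| * hDist 0 (hExp v) := by
  rw [← dil_hExp, hDist_hMul_hMul_right _ _ 0]
  have h0 : dil s (0 : Heis) = 0 := by simp [dil]
  have h1 : ∀ y, hMul (0 : Heis) y = y := fun y => by simp [hMul]
  rw [h1, ← hDist_dil, h0]

lemma hDist_hMul_hExp_smul_smul (x : Heis) (s t : ℝ) (v : ℝ × ℝ) :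
    hDist (hMul x (hExp (s • v))) (hMul x (hExp (t • v))) = |t - s| * hDist 0 (hExp v) := by
  rw [← hDist_hMul_hExp_smul (hMul x (hExp (s • v))), hMul_assoc, hExp_add_smul]
  congr 4; ring

lemma continuous_hMul : Continuous fun p : Heis × Heis => hMul p.1 p.2 := by
  unfold hMul; fun_prop

lemma continuous_dil : Continuous fun p : ℝ × Heis => dil p.1 p.2 := by
  unfold dil; fun_prop

lemma continuous_hExp : Continuous hExp := by unfold hExp; fun_prop

/-- The Heisenberg group with the homogeneous quasi-norm metric. -/
def HeisG : Type := Heis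

lemma isOpen_iff_hDist (s : Set Heis) :
    IsOpen s ↔ ∀ x ∈ s, ∃ ε > 0, ∀ y, hDist x y < ε → y ∈ s := by
  constructor
  · intro h x hx
    obtain ⟨δ, hδ, hs⟩ := Metric.isOpen_iff.1 h x hx
    refine ⟨min 1 (δ / (2 + |x.1|)), by positivity, fun y hy => hs ?_⟩
    obtain ⟨a1, a2, a3, -⟩ := hDist_bounds x y
    have h0 := hDist_nonneg x y
    set r := hDist x y
    have r1 : r < 1 := hy.trans_le (min_le_left _ _)
    have r2 : r * (2 + |x.1|) < δ := by
      have := hy.trans_le (min_le_right _ _)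
      rwa [lt_div_iff₀ (by positivity)] at this
    have hx0 := abs_nonneg x.1
    have a4 : |y.2.2 - x.2.2| ≤ r ^ 2 + |x.1| * r := by
      have : |x.1 * (y.2.1 - x.2.1)| ≤ |x.1| * r := by rw [abs_mul]; gcongr
      rw [show y.2.2 - x.2.2 = (y.2.2 - x.2.2 - x.1 * (y.2.1 - x.2.1)) + x.1 * (y.2.1 - x.2.1) by
        ring]
      exact (abs_add_le _ _).trans (add_le_add a3 this)
    rw [Metric.mem_ball, Prod.dist_eq, Prod.dist_eq, max_lt_iff, max_lt_iff, Real.dist_eq,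
      Real.dist_eq, Real.dist_eq]
    refine ⟨by nlinarith, by nlinarith, by nlinarith⟩
  · intro h
    refine isOpen_iff_mem_nhds.2 fun x hx => ?_
    obtain ⟨ε, hε, hs⟩ := h x hx
    have : Continuous fun y => hDist x y := continuous_hDist.comp (Continuous.prodMk_right x)
    have h2 : ∀ᶠ y in 𝓝 x, hDist x y < ε :=
      this.continuousAt.eventually_lt continuousAt_const (by rwa [hDist_self])
    exact mem_of_superset h2 hs

instance : MetricSpace HeisG :=
  MetricSpace.ofDistTopology (α := Heis) hDist hDist_self hDist_comm hDist_triangle isOpen_iff_hDist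
    (fun _ _ => eq_of_hDist_eq_zero)

instance : MeasureSpace HeisG := inferInstanceAs (MeasureSpace Heis)
instance : SecondCountableTopology HeisG := inferInstanceAs (SecondCountableTopology Heis)
instance : BorelSpace HeisG := inferInstanceAs (BorelSpace Heis)
instance : IsLocallyFiniteMeasure (volume : Measure HeisG) :=
  inferInstanceAs (IsLocallyFiniteMeasure (volume : Measure Heis))

lemma measurePreserving_hMul_left (g : Heis) :
    MeasurePreserving (hMul g) volume volume := by
  have h2 : MeasurePreserving (fun p : ℝ × ℝ => (g.2.1 + p.1, g.2.2 + g.1 * p.1 + p.2))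
      (volume.prod volume) (volume.prod volume) :=
    (measurePreserving_add_left volume g.2.1).skew_product
      (g := fun a b => g.2.2 + g.1 * a + b) (by fun_prop)
      (ae_of_all _ fun a => (measurePreserving_add_left volume _).map_eq)
  have h3 := (measurePreserving_add_left (volume : Measure ℝ) g.1).prod h2
  have e : hMul g = Prod.map (fun x => g.1 + x)
      fun p : ℝ × ℝ => (g.2.1 + p.1, g.2.2 + g.1 * p.1 + p.2) := by
    ext p <;> simp only [hMul, Prod.map]
    ring
  rw [e]
  exact h3

lemma measurePreserving_hMul_right (w : Heis) :
    MeasurePreserving (fun x => hMul x w) volume volume := by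
  have h3 : MeasurePreserving
      (fun p : ℝ × (ℝ × ℝ) => (p.1 + w.1, (p.2.1 + w.2.1, p.2.2 + (w.2.2 + p.1 * w.2.1))))
      (volume.prod (volume.prod volume)) (volume.prod (volume.prod volume)) :=
    (measurePreserving_add_right volume w.1).skew_product
      (g := fun (a : ℝ) (q : ℝ × ℝ) => (q.1 + w.2.1, q.2 + (w.2.2 + a * w.2.1))) (by fun_prop)
      (ae_of_all _ fun a => ((measurePreserving_add_right volume w.2.1).prod
        (measurePreserving_add_right volume (w.2.2 + a * w.2.1))).map_eq)
  have e : (fun x => hMul x w) = fun p : ℝ × (ℝ × ℝ) =>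
      (p.1 + w.1, (p.2.1 + w.2.1, p.2.2 + (w.2.2 + p.1 * w.2.1))) := by
    ext p <;> simp only [hMul]
    ring
  rw [e]
  exact h3

lemma map_dil {l : ℝ} (hl : 0 < l) :
    Measure.map (dil l) (volume : Measure Heis) = ENNReal.ofReal ((l ^ 4)⁻¹) • volume := by
  have e : dil l = Prod.map (l * ·) (Prod.map (l * ·) (l ^ 2 * ·)) := by ext <;> rfl
  have hm : ∀ c : ℝ, Measurable fun x : ℝ => c * x := fun c => by fun_prop
  rw [e, Measure.volume_eq_prod, Measure.volume_eq_prod,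
    ← Measure.map_prod_map _ _ (hm _) ((hm _).prodMap (hm _)),
    ← Measure.map_prod_map _ _ (hm _) (hm _), Real.map_volume_mul_left hl.ne',
    Real.map_volume_mul_left (pow_pos hl 2).ne']
  simp only [Measure.prod_smul_left, Measure.prod_smul_right, smul_smul]
  congr 1
  rw [← ENNReal.ofReal_mul (by positivity), ← ENNReal.ofReal_mul (by positivity),
    abs_of_pos (by positivity), abs_of_pos (by positivity)]
  congr 1
  field_simp

lemma measurable_hMul_dil (x : Heis) (l : ℝ) : Measurable fun w => hMul x (dil l w) := by
  unfold hMul dil; fun_prop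

lemma map_hMul_dil (x : Heis) {l : ℝ} (hl : 0 < l) :
    Measure.map (fun w => hMul x (dil l w)) (volume : Measure Heis)
      = ENNReal.ofReal ((l ^ 4)⁻¹) • volume := by
  have h := measurePreserving_hMul_left x
  have : (fun w => hMul x (dil l w)) = hMul x ∘ dil l := rfl
  rw [this, ← Measure.map_map h.measurable (by unfold dil; fun_prop), map_dil hl,
    Measure.map_smul, h.map_eq]

lemma hDist_hMul_dil (x : Heis) {l : ℝ} (hl : 0 < l) (w : Heis) :
    hDist x (hMul x (dil l w)) = l * hDist 0 w := by
  have h0 : hMul x (dil l 0) = x := by simp [hMul, dil]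
  conv_lhs => rw [← h0, hMul_assoc]
  rw [hDist_hMul_left]
  have : hMul (dil l 0) (dil l w) = dil l w := by simp [hMul, dil]
  rw [this, hDist_dil, abs_of_pos hl]

lemma preimage_hMul_dil (x : Heis) {l : ℝ} (hl : 0 < l) (R : ℝ) :
    (fun w => hMul x (dil l w)) ⁻¹' {y | hDist x y ≤ l * R} = {w | hDist 0 w ≤ R} := by
  ext w
  simp only [mem_preimage, mem_ofPred_eq, hDist_hMul_dil x hl, mul_le_mul_iff_right₀ hl]

lemma isClosed_hBall (x : Heis) (R : ℝ) : IsClosed {y | hDist x y ≤ R} :=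
  isClosed_le (continuous_hDist.comp (Continuous.prodMk_right x)) continuous_const

lemma volume_hBall (x : Heis) {l : ℝ} (hl : 0 < l) (R : ℝ) :
    volume {w | hDist 0 w ≤ R} = ENNReal.ofReal ((l ^ 4)⁻¹) * volume {y | hDist x y ≤ l * R} := by
  rw [← preimage_hMul_dil x hl, ← Measure.map_apply (measurable_hMul_dil x l)
    (isClosed_hBall _ _).measurableSet, map_hMul_dil x hl]
  rfl

lemma volume_hBall_lt_top (R : ℝ) : volume {w | hDist 0 w ≤ R} < ⊤ := by
  refine (measure_mono ?_).trans_lt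
    ((isCompact_Icc.prod (isCompact_Icc.prod isCompact_Icc)).measure_lt_top
      (K := Icc (-R) R ×ˢ (Icc (-R) R ×ˢ Icc (-R ^ 2) (R ^ 2))))
  intro w hw
  have hR : 0 ≤ R := (hDist_nonneg _ _).trans hw
  obtain ⟨h1, h2, h3, -⟩ := (hDist_le_iff hR).1 hw
  simp only [Prod.fst_zero, Prod.snd_zero, sub_zero, zero_mul, abs_le] at h1 h2 h3
  exact ⟨h1, h2, by simpa using h3⟩

lemma volume_hBall_pos {R : ℝ} (hR : 0 < R) : 0 < volume {w | hDist 0 w ≤ R} := by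
  have : IsOpen {w | hDist 0 w < R} :=
    isOpen_lt (continuous_hDist.comp (Continuous.prodMk_right 0)) continuous_const
  exact (this.measure_pos volume ⟨0, by simpa [hDist_self] using hR⟩).trans_le
    (measure_mono fun w (hw : hDist 0 w < R) => show hDist 0 w ≤ R from hw.le)

lemma heisG_closedBall (x : HeisG) (r : ℝ) :
    Metric.closedBall x r = {y : Heis | hDist x y ≤ r} := by
  ext y; rw [Metric.mem_closedBall, dist_comm]; rfl

instance : IsUnifLocDoublingMeasure (volume : Measure HeisG) where
  exists_measure_closedBall_le_mul'' := by
    refine ⟨16, ?_⟩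
    filter_upwards [self_mem_nhdsWithin] with ε hε x
    have hε : 0 < ε := hε
    have e := heisG_closedBall x
    have h1 := volume_hBall x hε 1
    have h2 := volume_hBall x (l := 2 * ε) (by positivity) 1
    rw [h1, mul_one, mul_one, show ((2 * ε) ^ 4)⁻¹ = (16 : ℝ)⁻¹ * (ε ^ 4)⁻¹ by ring,
      ENNReal.ofReal_mul (by norm_num), mul_assoc, mul_left_comm] at h2
    have h3 : ENNReal.ofReal (ε ^ 4)⁻¹ ≠ 0 := by
      rw [Ne, ENNReal.ofReal_eq_zero, not_le]; positivity
    have h4 := (ENNReal.mul_right_inj h3 ENNReal.ofReal_ne_top).1 h2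
    rw [e, e]
    change volume {y : Heis | hDist x y ≤ 2 * ε} ≤ _ * volume {y : Heis | hDist x y ≤ ε}
    rw [h4, ← mul_assoc, show ((16 : NNReal) : ENNReal) = ENNReal.ofReal 16 by norm_num,
      ← ENNReal.ofReal_mul (by norm_num)]
    norm_num

/-- `x` is a Lebesgue point of `ψ` with respect to the homogeneous balls. -/
def IsHLebesguePoint (ψ : Heis → ℝ) (x : Heis) : Prop :=
  ∀ R > 0, Tendsto (fun l : ℝ => ∫⁻ w in {w | hDist 0 w ≤ R},
    ‖ψ (hMul x (dil l w)) - ψ x‖ₑ) (𝓝[>] 0) (𝓝 0)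

lemma ae_tendsto_lintegral_closedBall {ψ : HeisG → ℝ} (hψ : LocallyIntegrable ψ volume) :
    ∀ᵐ x : HeisG, ∀ R > 0, Tendsto (fun l : ℝ =>
      (∫⁻ y in {y : Heis | hDist x y ≤ l * R}, ‖ψ y - ψ x‖ₑ) /
      volume {y : Heis | hDist x y ≤ l * R}) (𝓝[>] 0) (𝓝 0) := by
  filter_upwards [(IsUnifLocDoublingMeasure.vitaliFamily (volume : Measure HeisG)
    1).ae_tendsto_lintegral_enorm_sub_div hψ] with x hx R hR
  have hlim : Tendsto (fun l : ℝ => l * R) (𝓝[>] 0) (𝓝[>] 0) := by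
    refine tendsto_nhdsWithin_iff.2 ⟨?_, ?_⟩
    · refine tendsto_nhdsWithin_of_tendsto_nhds ?_
      simpa using (continuous_mul_const R).tendsto 0
    · filter_upwards [self_mem_nhdsWithin] with l hl using mul_pos hl hR
  have h1 := hx.comp (IsUnifLocDoublingMeasure.tendsto_closedBall_filterAt (volume : Measure HeisG)
    (fun _ : ℝ => x) (fun l => l * R) hlim (by
      filter_upwards [self_mem_nhdsWithin] with l hl
      exact Metric.mem_closedBall_self (by have : 0 < l := hl; positivity)))
  refine h1.congr fun l => ?_
  rw [Function.comp_apply, heisG_closedBall]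
  rfl

lemma ae_isHLebesguePoint {ψ : Heis → ℝ} (hψ : Measurable ψ) {C : ℝ} (hC : ∀ x, |ψ x| ≤ C) :
    ∀ᵐ x, IsHLebesguePoint ψ x := by
  have hloc : LocallyIntegrable (fun x : Heis => ψ x) volume := by
    have : LocallyIntegrable (fun _ : Heis => C) volume := locallyIntegrable_const C
    refine this.mono hψ.aestronglyMeasurable (ae_of_all _ fun x => ?_)
    exact (hC x).trans (le_abs_self _)
  have : ∀ᵐ x : Heis, ∀ R > 0, Tendsto (fun l : ℝ =>
      (∫⁻ y in {y : Heis | hDist x y ≤ l * R}, ‖ψ y - ψ x‖ₑ) /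
      volume {y : Heis | hDist x y ≤ l * R}) (𝓝[>] 0) (𝓝 0) :=
    ae_tendsto_lintegral_closedBall hloc
  filter_upwards [this] with x hx R hR
  have h2 := ENNReal.Tendsto.const_mul (a := volume {w : Heis | hDist 0 w ≤ R}) (hx R hR)
    (Or.inr (volume_hBall_lt_top R).ne)
  rw [mul_zero] at h2
  refine h2.congr' ?_
  filter_upwards [self_mem_nhdsWithin] with l hl
  have hl : 0 < l := hl
  have hv := volume_hBall x hl R
  have hpos := (volume_hBall_pos hR).ne'
  have hfin := (volume_hBall_lt_top R).ne
  have hm : Measurable fun y => ‖ψ y - ψ x‖ₑ := by fun_prop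
  have h3 := setLIntegral_map (μ := volume) (isClosed_hBall x (l * R)).measurableSet hm
    (measurable_hMul_dil x l)
  rw [preimage_hMul_dil x hl, map_hMul_dil x hl, Measure.restrict_smul, lintegral_smul_measure]
    at h3
  rw [← h3, smul_eq_mul]
  rw [hv] at hpos hfin ⊢
  have hne : volume {y : Heis | hDist x y ≤ l * R} ≠ 0 := right_ne_zero_of_mul hpos
  have hnt : volume {y : Heis | hDist x y ≤ l * R} ≠ ⊤ := fun h => by
    rw [h, ENNReal.mul_top (left_ne_zero_of_mul hpos)] at hfin; exact hfin rfl
  rw [mul_assoc, ENNReal.mul_div_cancel hne hnt]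

lemma volume_hBall_pos' (z : Heis) {η : ℝ} (hη : 0 < η) : 0 < volume {w | hDist z w ≤ η} := by
  have h := volume_hBall z one_pos η
  have h2 := volume_hBall_pos hη
  simpa [h] using h2

/-- Near a Lebesgue point of `ψ`, every rescaled horizontal segment can be moved slightly so that
`ψ` is close to its limit in mean along it. -/
lemma IsHLebesguePoint.exists_segment {ψ : Heis → ℝ} (hψ : Measurable ψ) {x : Heis}
    (hx : IsHLebesguePoint ψ x) (z : Heis) (v : ℝ × ℝ) {η : ℝ} (hη : 0 < η) {ε : ENNReal}
    (hε : 0 < ε) :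
    ∀ᶠ l : ℝ in 𝓝[>] 0, ∃ z', hDist z z' ≤ η ∧
      ∫⁻ s in Ioc (0 : ℝ) 1, ‖ψ (hMul x (dil l (hMul z' (hExp (s • v))))) - ψ x‖ₑ ≤ ε := by
  set R := hDist 0 z + η + hDist 0 (hExp v) with hR
  have hRpos : 0 < R := by
    have := hDist_nonneg 0 z
    have := hDist_nonneg 0 (hExp v)
    positivity
  have hpos := volume_hBall_pos' z hη
  filter_upwards [(hx R hRpos).eventually_lt_const (ENNReal.mul_pos hε.ne' hpos.ne')] with l hl
  by_contra! hcon
  set F : Heis → ENNReal := fun w => ‖ψ (hMul x (dil l w)) - ψ x‖ₑ with hF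
  have hFm : Measurable F := by
    have := hψ.comp (measurable_hMul_dil x l)
    exact (this.sub_const _).enorm
  have hFm2 : Measurable fun p : Heis × ℝ => F (hMul p.1 (hExp (p.2 • v))) := by
    refine hFm.comp (Continuous.measurable ?_)
    unfold hMul hExp; simp only [Prod.smul_fst, Prod.smul_snd, smul_eq_mul]; fun_prop
  have h1 : ε * volume {w | hDist z w ≤ η} ≤
      ∫⁻ w in {w | hDist z w ≤ η}, ∫⁻ s in Ioc (0 : ℝ) 1, F (hMul w (hExp (s • v))) := by
    rw [← setLIntegral_const]
    exact setLIntegral_mono' (isClosed_hBall z η).measurableSet fun w hw => (hcon w hw).le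
  have h2 : ∫⁻ w in {w | hDist z w ≤ η}, ∫⁻ s in Ioc (0 : ℝ) 1, F (hMul w (hExp (s • v)))
      = ∫⁻ s in Ioc (0 : ℝ) 1, ∫⁻ w in {w | hDist z w ≤ η}, F (hMul w (hExp (s • v))) :=
    lintegral_lintegral_swap hFm2.aemeasurable
  have h3 : ∫⁻ s in Ioc (0 : ℝ) 1, ∫⁻ w in {w | hDist z w ≤ η}, F (hMul w (hExp (s • v)))
      ≤ ∫⁻ _ in Ioc (0 : ℝ) 1, ∫⁻ w in {w | hDist 0 w ≤ R}, F w := by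
    refine setLIntegral_mono' measurableSet_Ioc fun s hs => ?_
    rw [← (measurePreserving_hMul_right (hExp (s • v))).setLIntegral_comp_preimage
      (isClosed_hBall 0 R).measurableSet hFm]
    refine lintegral_mono_set fun w (hw : hDist z w ≤ η) => ?_
    show hDist 0 (hMul w (hExp (s • v))) ≤ R
    have a1 := hDist_triangle 0 w (hMul w (hExp (s • v)))
    have a2 := hDist_triangle 0 z w
    rw [hDist_hMul_hExp_smul, abs_of_pos hs.1] at a1
    have a3 : s * hDist 0 (hExp v) ≤ hDist 0 (hExp v) :=
      mul_le_of_le_one_left (hDist_nonneg _ _) hs.2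
    linarith
  rw [setLIntegral_const, Real.volume_Ioc, sub_zero, ENNReal.ofReal_one, mul_one] at h3
  exact absurd ((h1.trans_eq h2).trans h3) (not_le.2 hl)

lemma integral_eq_sub_of_lipschitzOn {F v : ℝ → ℝ} {K : NNReal}
    (hF : LipschitzOnWith K F (Icc 0 1))
    (hv : ∀ᵐ t : ℝ, t ∈ Icc (0 : ℝ) 1 → HasDerivAt F (v t) t) {t : ℝ} (ht : t ∈ Icc (0 : ℝ) 1) :
    IntervalIntegrable v volume 0 t ∧ ∫ s in (0 : ℝ)..t, v s = F t - F 0 := by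
  have hsub : uIcc 0 t ⊆ Icc (0 : ℝ) 1 := by
    rw [uIcc_of_le ht.1]; exact Icc_subset_Icc_right ht.2
  have hac := (hF.mono hsub).absolutelyContinuousOnInterval
  have hae : ∀ᵐ s : ℝ, s ∈ uIoc 0 t → deriv F s = v s := by
    filter_upwards [hv] with s hs hst
    exact (hs (hsub (uIoc_subset_uIcc hst))).deriv
  refine ⟨hac.intervalIntegrable_deriv.congr_ae
    ((ae_restrict_iff' measurableSet_uIoc).2 hae), ?_⟩
  rw [← hac.integral_deriv_eq_sub]
  exact (intervalIntegral.integral_congr_ae hae).symm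

lemma pathLen_nonneg (v₁ v₂ : ℝ → ℝ) : 0 ≤ pathLen v₁ v₂ :=
  intervalIntegral.integral_nonneg zero_le_one fun _ _ => Real.sqrt_nonneg _

lemma abs_le_sqrt_add_sq_left (a b : ℝ) : |a| ≤ √(a ^ 2 + b ^ 2) :=
  Real.abs_le_sqrt (by nlinarith [sq_nonneg b])

lemma abs_le_sqrt_add_sq_right (a b : ℝ) : |b| ≤ √(a ^ 2 + b ^ 2) :=
  Real.abs_le_sqrt (by nlinarith [sq_nonneg a])

lemma sqrt_add_sq_le (a b : ℝ) : √(a ^ 2 + b ^ 2) ≤ |a| + |b| := by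
  refine Real.sqrt_le_iff.2 ⟨by positivity, ?_⟩
  rw [← sq_abs a, ← sq_abs b]
  nlinarith [abs_nonneg a, abs_nonneg b]

/-- A horizontal path between two points of the same vertical line is at least as long as the
square root of their vertical separation. -/
lemma sqrt_le_pathLen {c : ℝ → Heis} {v₁ v₂ : ℝ → ℝ} {K : NNReal}
    (hK : LipschitzOnWith K c (Icc 0 1)) (hc : IsHorizPath c v₁ v₂)
    (hi : IntervalIntegrable (fun t => √(v₁ t ^ 2 + v₂ t ^ 2)) volume 0 1)
    (h1 : (c 1).2.1 = (c 0).2.1) {h : ℝ} (h2 : (c 1).2.2 - (c 0).2.2 = h) :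
    √h ≤ pathLen v₁ v₂ := by
  have e1 : (1 : ℝ) ∈ Icc (0 : ℝ) 1 := ⟨zero_le_one, le_rfl⟩
  have L1 : LipschitzOnWith (1 * K) (fun t => (c t).1) (Icc 0 1) :=
    LipschitzWith.prod_fst.comp_lipschitzOnWith hK
  have L2 : LipschitzOnWith (1 * (1 * K)) (fun t => (c t).2.1) (Icc 0 1) :=
    LipschitzWith.prod_fst.comp_lipschitzOnWith (LipschitzWith.prod_snd.comp_lipschitzOnWith hK)
  have L3 : LipschitzOnWith (1 * (1 * K)) (fun t => (c t).2.2) (Icc 0 1) :=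
    LipschitzWith.prod_snd.comp_lipschitzOnWith (LipschitzWith.prod_snd.comp_lipschitzOnWith hK)
  have I1 := fun t ht => integral_eq_sub_of_lipschitzOn (t := t) L1
    (hc.mono fun t h ht => (h ht).1) ht
  obtain ⟨I2, J2⟩ := integral_eq_sub_of_lipschitzOn L2 (hc.mono fun t h ht => (h ht).2.1) e1
  obtain ⟨I3, J3⟩ := integral_eq_sub_of_lipschitzOn L3 (hc.mono fun t h ht => (h ht).2.2) e1
  set ℓ := pathLen v₁ v₂ with hℓ
  have hb : ∀ t ∈ Icc (0 : ℝ) 1, |(c t).1 - (c 0).1| ≤ ℓ := fun t ht => by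
    obtain ⟨I, J⟩ := I1 t ht
    rw [← J]
    have hi' : IntervalIntegrable (fun t => √(v₁ t ^ 2 + v₂ t ^ 2)) volume 0 t :=
      hi.mono_set (by rw [uIcc_of_le ht.1, uIcc_of_le zero_le_one]; exact Icc_subset_Icc_right ht.2)
    refine (intervalIntegral.norm_integral_le_of_norm_le (f := v₁) ht.1
      (ae_of_all _ fun s _ => abs_le_sqrt_add_sq_left (v₁ s) (v₂ s)) hi').trans ?_
    exact intervalIntegral.integral_mono_interval le_rfl ht.1 ht.2
      (ae_of_all _ fun _ => Real.sqrt_nonneg _) hi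
  have key : ∫ t in (0 : ℝ)..1, ((c t).1 * v₂ t - (c 0).1 * v₂ t) = h := by
    rw [intervalIntegral.integral_sub I3 (I2.const_mul _), J3,
      intervalIntegral.integral_const_mul, J2, h1, h2]
    ring
  have hle : |h| ≤ ℓ * ℓ := by
    rw [← key]
    have := intervalIntegral.norm_integral_le_of_norm_le zero_le_one
      (f := fun t => (c t).1 * v₂ t - (c 0).1 * v₂ t) (g := fun t => ℓ * √(v₁ t ^ 2 + v₂ t ^ 2))
      (ae_of_all _ fun t ht => by
        rw [← sub_mul, norm_mul]
        exact mul_le_mul (hb t (Ioc_subset_Icc_self ht)) (abs_le_sqrt_add_sq_right _ _)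
          (norm_nonneg _) (pathLen_nonneg _ _)) (hi.const_mul ℓ)
    rwa [intervalIntegral.integral_const_mul] at this
  exact Real.sqrt_le_iff.2 ⟨pathLen_nonneg _ _, by nlinarith [le_abs_self h]⟩

/-- Any two points are joined by a polynomial horizontal path of length comparable to their
homogeneous distance. -/
lemma exists_path (x y : Heis) : ∃ c : ℝ → Heis, ∃ v₁ v₂ : ℝ → ℝ,
    (∃ K : NNReal, LipschitzOnWith K c (Icc 0 1)) ∧ IsHorizPath c v₁ v₂ ∧
    IntervalIntegrable (fun t => √(v₁ t ^ 2 + v₂ t ^ 2)) volume 0 1 ∧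
    c 0 = x ∧ c 1 = y ∧ pathLen v₁ v₂ ≤ 38 * hDist x y := by
  obtain ⟨b1, b2, b3, b4⟩ := hDist_bounds x y
  have hr := hDist_nonneg x y
  set r := hDist x y
  set a := y.1 - x.1 with ha
  set b := y.2.1 - x.2.1 with hb
  set m := y.2.2 - x.2.2 - x.1 * b - a * b / 2 with hm
  set A := √|m| with hA
  set D := 5 * b - 30 * (m / A) with hD
  have hAD : A * D = 5 * A * b - 30 * m := by
    by_cases h : m = 0
    · simp [hD, hA, h]
    · have : A ≠ 0 := by rw [hA]; positivity
      rw [hD]; field_simp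
  have hmA : |m / A| = A := by rw [abs_div, abs_of_nonneg (Real.sqrt_nonneg |m| : 0 ≤ A), hA,
    Real.div_sqrt]
  have hAr : A ≤ r := by
    refine Real.sqrt_le_iff.2 ⟨hr, ?_⟩
    rw [abs_le] at *
    have : y.2.2 - x.2.2 - y.1 * b = y.2.2 - x.2.2 - x.1 * b - a * b := by rw [ha]; ring
    rw [this] at b4
    constructor <;> linarith
  have hA0 : 0 ≤ A := Real.sqrt_nonneg _
  have hDr : |D| ≤ 5 * r + 30 * r := by
    refine (abs_sub _ _).trans ?_
    rw [abs_mul, abs_mul, hmA]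
    norm_num
    linarith
  let p : ℝ → ℝ := fun t => a * t + A * (t - t ^ 2)
  let q : ℝ → ℝ := fun t => b * t + D * (t - 3 * t ^ 2 + 2 * t ^ 3)
  let u : ℝ → ℝ := fun t => (a + A) * (b + D) * t ^ 2 / 2 -
    (6 * D * (a + A) + A * (b + D)) * t ^ 3 / 3 + (6 * D * (a + A) + 6 * A * D) * t ^ 4 / 4
    - 6 * A * D * t ^ 5 / 5
  let v₁ : ℝ → ℝ := fun t => a + A * (1 - 2 * t)
  let v₂ : ℝ → ℝ := fun t => b + D * (1 - 6 * t + 6 * t ^ 2)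
  have hp : ∀ t, HasDerivAt p (v₁ t) t := fun t => by
    have := ((hasDerivAt_id t).const_mul a).add
      (((hasDerivAt_id t).sub (hasDerivAt_pow 2 t)).const_mul A)
    refine this.congr_deriv ?_
    simp [v₁]
  have hq : ∀ t, HasDerivAt q (v₂ t) t := fun t => by
    have := ((hasDerivAt_id t).const_mul b).add
      ((((hasDerivAt_id t).sub ((hasDerivAt_pow 2 t).const_mul 3)).add
        ((hasDerivAt_pow 3 t).const_mul 2)).const_mul D)
    refine this.congr_deriv ?_
    simp only [v₂]; push_cast; ring
  have hu : ∀ t, HasDerivAt u (p t * v₂ t) t := fun t => by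
    have := (((((hasDerivAt_pow 2 t).const_mul ((a + A) * (b + D))).div_const 2).sub
      (((hasDerivAt_pow 3 t).const_mul (6 * D * (a + A) + A * (b + D))).div_const 3)).add
      (((hasDerivAt_pow 4 t).const_mul (6 * D * (a + A) + 6 * A * D)).div_const 4)).sub
      (((hasDerivAt_pow 5 t).const_mul (6 * A * D)).div_const 5)
    refine this.congr_deriv ?_
    simp [v₂, p]; ring
  refine ⟨fun t => (x.1 + p t, x.2.1 + q t, x.2.2 + x.1 * q t + u t), v₁, v₂, ?_,
    ae_of_all _ fun t _ => ⟨(hp t).const_add _, (hq t).const_add _, ?_⟩, ?_, ?_, ?_, ?_⟩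
  · have : ContDiffOn ℝ 1 (fun t => (x.1 + p t, x.2.1 + q t, x.2.2 + x.1 * q t + u t))
        (Icc (0 : ℝ) 1) := by
      apply ContDiff.contDiffOn; simp only [p, q, u]; fun_prop
    exact this.exists_lipschitzOnWith one_ne_zero (convex_Icc _ _) isCompact_Icc
  · refine ((((hq t).const_mul x.1).const_add x.2.2).add (hu t)).congr_deriv ?_
    simp only; ring
  · apply Continuous.intervalIntegrable; simp only [v₁, v₂]; fun_prop
  · simp [p, q, u]
  · have e : u 1 = y.2.2 - x.2.2 - x.1 * b := by
      simp only [u]; linear_combination (-1 / 30 : ℝ) * hAD + hm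
    have e2 : q 1 = b := by simp only [q]; ring
    have e1 : p 1 = a := by simp only [p]; ring
    simp only [e, e1, e2, ha, hb]
    ext <;> simp
  · have hle : ∀ t ∈ Icc (0 : ℝ) 1, √(v₁ t ^ 2 + v₂ t ^ 2) ≤ 38 * r := fun t ht => by
      refine (sqrt_add_sq_le _ _).trans ?_
      have h1 : |v₁ t| ≤ r + r := by
        refine (abs_add_le _ _).trans (add_le_add b1 ?_)
        rw [abs_mul, abs_of_nonneg hA0]
        have : |1 - 2 * t| ≤ 1 := abs_le.2 ⟨by linarith [ht.2], by linarith [ht.1]⟩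
        nlinarith
      have h2 : |v₂ t| ≤ r + (5 * r + 30 * r) := by
        refine (abs_add_le _ _).trans (add_le_add b2 ?_)
        rw [abs_mul]
        have : |1 - 6 * t + 6 * t ^ 2| ≤ 1 :=
          abs_le.2 ⟨by nlinarith [sq_nonneg (2 * t - 1)], by nlinarith [ht.1, ht.2]⟩
        nlinarith [abs_nonneg D]
      linarith
    have := intervalIntegral.integral_mono_on (μ := volume) zero_le_one
      (by apply Continuous.intervalIntegrable; simp only [v₁, v₂]; fun_prop)
      (intervalIntegrable_const (c := 38 * r)) hle
    simpa [pathLen] using this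

lemma ccDist_le (x y : Heis) : ccDist x y ≤ 38 * hDist x y := by
  obtain ⟨c, v₁, v₂, hL, hh, hi, h0, h1, hle⟩ := exists_path x y
  refine (csInf_le ⟨0, ?_⟩ ?_).trans hle
  · rintro _ ⟨c, v₁, v₂, -, -, -, -, -, rfl⟩
    exact pathLen_nonneg _ _
  · exact ⟨c, v₁, v₂, hL, hh, hi, h0, h1, rfl⟩

lemma ccDist_nonneg (x y : Heis) : 0 ≤ ccDist x y := by
  refine Real.sInf_nonneg ?_
  rintro _ ⟨c, v₁, v₂, -, -, -, -, -, rfl⟩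
  exact pathLen_nonneg _ _

lemma sqrt_le_ccDist (x : Heis) (h : ℝ) : √h ≤ ccDist x (hMul x (0, 0, h)) := by
  obtain ⟨c, v₁, v₂, hL, hh, hi, h0, h1, -⟩ := exists_path x (hMul x (0, 0, h))
  refine le_csInf ⟨_, c, v₁, v₂, hL, hh, hi, h0, h1, rfl⟩ ?_
  rintro _ ⟨c, v₁, v₂, ⟨K, hL⟩, hh, hi, h0, h1, rfl⟩
  refine sqrt_le_pathLen hL hh hi ?_ ?_
  · rw [h0, h1]; simp [hMul]
  · rw [h0, h1]; simp [hMul]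

/-- A refining sequence of finite families of functionals `T n σ`, dominated by seminorms `M n σ`
adding up to the norm. -/
structure SignFamily (E : Type*) [NormedAddCommGroup E] [NormedSpace ℝ E] where
  /-- The index set at each level. -/
  I : ℕ → Finset (Finset ℕ)
  /-- The functionals. -/
  T : ℕ → Finset ℕ → E →ₗ[ℝ] ℝ
  /-- The dominating seminorms. -/
  M : ℕ → Finset ℕ → Seminorm ℝ E
  abs_T_le : ∀ n σ φ, |T n σ φ| ≤ M n σ φ
  M_le : ∀ n σ φ, M n σ φ ≤ ‖φ‖
  sum_M : ∀ n φ, ∑ σ ∈ I n, M n σ φ = ‖φ‖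
  sum_abs_T_mono : ∀ φ, Monotone fun n => ∑ σ ∈ I n, |T n σ φ|

section Partition

variable {Y : Type*}

/-- The cells of the partition generated by the first `n` sets of a sequence. -/
def partCell (S : ℕ → Set Y) (n : ℕ) (σ : Finset ℕ) : Set Y :=
  ⋂ i ∈ Finset.range n, if i ∈ σ then S i else (S i)ᶜ

lemma mem_partCell {S : ℕ → Set Y} {n : ℕ} {σ : Finset ℕ} {y : Y} :
    y ∈ partCell S n σ ↔ ∀ i < n, (y ∈ S i ↔ i ∈ σ) := by
  simp only [partCell, mem_iInter, Finset.mem_range]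
  refine forall₂_congr fun i _ => ?_
  by_cases h : i ∈ σ <;> simp [h]

lemma partCell_succ_insert (S : ℕ → Set Y) {n : ℕ} {σ : Finset ℕ} (hσ : σ ⊆ Finset.range n) :
    partCell S (n + 1) (insert n σ) = partCell S n σ ∩ S n := by
  ext y
  simp only [mem_inter_iff, mem_partCell, Nat.lt_succ_iff_lt_or_eq, Finset.mem_insert]
  constructor
  · intro h
    refine ⟨fun i hi => ?_, (h n (Or.inr rfl)).2 (Or.inl rfl)⟩
    rw [h i (Or.inl hi)]
    simp [hi.ne]
  · rintro ⟨h, hn⟩ i (hi | rfl)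
    · rw [h i hi]; simp [hi.ne]
    · simp [hn]

lemma partCell_succ (S : ℕ → Set Y) {n : ℕ} {σ : Finset ℕ} (hσ : σ ⊆ Finset.range n) :
    partCell S (n + 1) σ = partCell S n σ \ S n := by
  have hn : n ∉ σ := fun h => by simpa using hσ h
  ext y
  simp only [Set.mem_sdiff, mem_partCell, Nat.lt_succ_iff_lt_or_eq]
  constructor
  · intro h
    exact ⟨fun i hi => h i (Or.inl hi), fun h' => hn ((h n (Or.inr rfl)).1 h')⟩
  · rintro ⟨h, hn'⟩ i (hi | rfl)
    · exact h i hi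
    · simp [hn, hn']

variable [MeasurableSpace Y]

lemma measurableSet_partCell {S : ℕ → Set Y} (hS : ∀ i, MeasurableSet (S i)) (n : ℕ)
    (σ : Finset ℕ) : MeasurableSet (partCell S n σ) := by
  refine Finset.measurableSet_biInter _ fun i _ => ?_
  split_ifs
  exacts [hS i, (hS i).compl]

variable {ν : Measure Y}

lemma setIntegral_partCell_succ {S : ℕ → Set Y} (hS : ∀ i, MeasurableSet (S i)) {n : ℕ}
    {σ : Finset ℕ} (hσ : σ ⊆ Finset.range n) {g : Y → ℝ} (hg : Integrable g ν) :
    ∫ y in partCell S n σ, g y ∂ν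
      = ∫ y in partCell S (n + 1) σ, g y ∂ν + ∫ y in partCell S (n + 1) (insert n σ), g y ∂ν := by
  rw [partCell_succ_insert S hσ, partCell_succ S hσ, add_comm]
  exact (integral_inter_add_sdiff (hS n) hg.integrableOn).symm

lemma sum_setIntegral_partCell {S : ℕ → Set Y} (hS : ∀ i, MeasurableSet (S i)) (n : ℕ)
    {g : Y → ℝ} (hg : Integrable g ν) :
    ∑ σ ∈ (Finset.range n).powerset, ∫ y in partCell S n σ, g y ∂ν = ∫ y, g y ∂ν := by
  induction n with
  | zero => simp [partCell]
  | succ n ih =>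
    rw [Finset.range_add_one, Finset.sum_powerset_insert (by simp), ← ih, ← Finset.sum_add_distrib]
    exact Finset.sum_congr rfl fun σ hσ =>
      (setIntegral_partCell_succ hS (Finset.mem_powerset.1 hσ) hg).symm

lemma sum_abs_setIntegral_partCell_mono {S : ℕ → Set Y} (hS : ∀ i, MeasurableSet (S i))
    {g : Y → ℝ} (hg : Integrable g ν) :
    Monotone fun n => ∑ σ ∈ (Finset.range n).powerset, |∫ y in partCell S n σ, g y ∂ν| := by
  refine monotone_nat_of_le_succ fun n => ?_
  rw [Finset.range_add_one, Finset.sum_powerset_insert (by simp), ← Finset.sum_add_distrib]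
  refine Finset.sum_le_sum fun σ hσ => ?_
  rw [setIntegral_partCell_succ hS (Finset.mem_powerset.1 hσ) hg]
  exact abs_add_le _ _

/-- The functional `φ ↦ ∫_B φ` on `L¹`. -/
def setIntegralLp (ν : Measure Y) (B : Set Y) : Lp ℝ 1 ν →ₗ[ℝ] ℝ where
  toFun φ := ∫ y in B, φ y ∂ν
  map_add' φ ψ := by
    rw [← integral_add (L1.integrable_coeFn φ).integrableOn (L1.integrable_coeFn ψ).integrableOn]
    exact integral_congr_ae (ae_restrict_of_ae (Lp.coeFn_add φ ψ))
  map_smul' c φ := by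
    rw [RingHom.id_apply, ← integral_smul]
    exact integral_congr_ae (ae_restrict_of_ae (Lp.coeFn_smul c φ))

/-- The seminorm `φ ↦ ∫_B |φ|` on `L¹`. -/
def setNormLp (ν : Measure Y) (B : Set Y) : Seminorm ℝ (Lp ℝ 1 ν) :=
  Seminorm.of (fun φ => ∫ y in B, |φ y| ∂ν)
    (fun φ ψ => by
      rw [← integral_add (L1.integrable_coeFn φ).abs.integrableOn
        (L1.integrable_coeFn ψ).abs.integrableOn]
      refine integral_mono_ae (L1.integrable_coeFn _).abs.integrableOn
        ((L1.integrable_coeFn φ).abs.add (L1.integrable_coeFn ψ).abs).integrableOn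
        (ae_restrict_of_ae ?_)
      filter_upwards [Lp.coeFn_add φ ψ] with y hy
      rw [hy]
      exact abs_add_le _ _)
    (fun c φ => by
      rw [Real.norm_eq_abs, ← integral_const_mul]
      refine integral_congr_ae (ae_restrict_of_ae ?_)
      filter_upwards [Lp.coeFn_smul c φ] with y hy
      rw [hy, Pi.smul_apply, smul_eq_mul, abs_mul])

lemma exists_signFamily (φ : ℕ → Lp ℝ 1 ν) : ∃ F : SignFamily (Lp ℝ 1 ν),
    ∀ k, ∃ n, ‖φ k‖ ≤ ∑ σ ∈ F.I n, |F.T n σ (φ k)| := by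
  set S : ℕ → Set Y := fun k => {y | 0 < φ k y} with hSdef
  have hS : ∀ k, MeasurableSet (S k) := fun k =>
    measurableSet_lt measurable_const (Lp.stronglyMeasurable (φ k)).measurable
  have hnorm : ∀ ψ : Lp ℝ 1 ν, ‖ψ‖ = ∫ y, |ψ y| ∂ν := fun ψ => L1.norm_eq_integral_norm ψ
  have hsum : ∀ n (ψ : Lp ℝ 1 ν), ∑ σ ∈ (Finset.range n).powerset,
      setNormLp ν (partCell S n σ) ψ = ‖ψ‖ := fun n ψ => by
    rw [hnorm]
    exact sum_setIntegral_partCell hS n (L1.integrable_coeFn ψ).abs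
  let F : SignFamily (Lp ℝ 1 ν) :=
    { I := fun n => (Finset.range n).powerset
      T := fun n σ => setIntegralLp ν (partCell S n σ)
      M := fun n σ => setNormLp ν (partCell S n σ)
      abs_T_le := fun n σ ψ => abs_integral_le_integral_abs
      M_le := fun n σ ψ => by
        rw [hnorm]
        exact setIntegral_le_integral (L1.integrable_coeFn ψ).abs (ae_of_all _ fun _ => abs_nonneg _)
      sum_M := hsum
      sum_abs_T_mono := fun ψ => sum_abs_setIntegral_partCell_mono hS (L1.integrable_coeFn ψ) }
  refine ⟨F, fun k => ⟨k + 1, ?_⟩⟩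
  rw [← F.sum_M (k + 1)]
  refine Finset.sum_le_sum fun σ _ => ?_
  show ∫ y in partCell S (k + 1) σ, |φ k y| ∂ν ≤ |∫ y in partCell S (k + 1) σ, φ k y ∂ν|
  have hm := measurableSet_partCell hS (k + 1) σ
  by_cases hk : k ∈ σ
  · refine (le_of_eq ?_).trans (le_abs_self _)
    refine setIntegral_congr_fun hm fun y hy => abs_of_pos ?_
    exact (mem_partCell.1 hy k k.lt_succ_self).2 hk
  · refine (le_of_eq ?_).trans (neg_le_abs _)
    rw [← integral_neg]
    refine setIntegral_congr_fun hm fun y hy => abs_of_nonpos ?_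
    have : y ∉ S k := fun h => hk ((mem_partCell.1 hy k k.lt_succ_self).1 h)
    exact not_lt.1 this

end Partition

section SignFamily

variable {E : Type*} [NormedAddCommGroup E] [NormedSpace ℝ E] (F : SignFamily E)

lemma SignFamily.sum_abs_T_le (n : ℕ) (φ : E) : ∑ σ ∈ F.I n, |F.T n σ φ| ≤ ‖φ‖ := by
  rw [← F.sum_M n]
  exact Finset.sum_le_sum fun σ _ => F.abs_T_le n σ φ

/-- `F` computes the norm of all the differences of values of `f`. -/
def SignFamily.Norming {X : Type*} (f : X → E) : Prop :=
  ∀ z z' : X, ∀ ε > 0, ∃ n, ‖f z - f z'‖ ≤ ∑ σ ∈ F.I n, |F.T n σ (f z - f z')| + ε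

end SignFamily

lemma exists_signFamily_norming {Y : Type*} [MeasurableSpace Y] {ν : Measure Y} {X : Type*}
    [TopologicalSpace X] [SecondCountableTopology X] [Nonempty X] {f : X → Lp ℝ 1 ν}
    (hf : Continuous f) : ∃ F : SignFamily (Lp ℝ 1 ν), F.Norming f := by
  let d := TopologicalSpace.denseSeq X
  obtain ⟨F, hF⟩ := exists_signFamily fun k => f (d k.unpair.1) - f (d k.unpair.2)
  refine ⟨F, fun z z' ε hε => ?_⟩
  have happ : ∀ z, ∃ i, ‖f z - f (d i)‖ < ε / 4 := fun z => by
    have : {w | ‖f z - f w‖ < ε / 4} ∈ 𝓝 z := by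
      refine (Continuous.continuousAt (by fun_prop)).eventually_lt continuousAt_const ?_
      rw [sub_self, norm_zero]; positivity
    obtain ⟨w, ⟨i, rfl⟩, hw⟩ := (TopologicalSpace.denseRange_denseSeq X).inter_nhds_nonempty this
    exact ⟨i, hw⟩
  obtain ⟨i, hi⟩ := happ z
  obtain ⟨j, hj⟩ := happ z'
  obtain ⟨n, hn⟩ := hF (Nat.pair i j)
  simp only [Nat.unpair_pair] at hn
  refine ⟨n, ?_⟩
  set φ := f z - f z'
  set ψ := f (d i) - f (d j)
  have h1 : ‖φ - ψ‖ ≤ ε / 2 := by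
    have : φ - ψ = (f z - f (d i)) - (f z' - f (d j)) := by simp only [φ, ψ]; abel
    rw [this]
    exact (norm_sub_le _ _).trans (by linarith)
  have h2 : ∑ σ ∈ F.I n, |F.T n σ ψ| ≤ ∑ σ ∈ F.I n, |F.T n σ φ| + ‖φ - ψ‖ := by
    refine le_trans ?_ (add_le_add le_rfl (F.sum_abs_T_le n (φ - ψ)))
    rw [← Finset.sum_add_distrib]
    refine Finset.sum_le_sum fun σ _ => ?_
    have : F.T n σ ψ = F.T n σ φ - F.T n σ (φ - ψ) := by
      rw [map_sub (F.T n σ) φ ψ]; ring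
    rw [this]
    exact abs_sub _ _
  have h3 : ‖φ‖ ≤ ‖ψ‖ + ‖φ - ψ‖ := by
    have := norm_add_le ψ (φ - ψ)
    rwa [add_sub_cancel] at this
  linarith

/-- The derivative of `g` at `x` along the horizontal line with direction `v`. -/
def derivH (g : Heis → ℝ) (v : ℝ × ℝ) (x : Heis) : ℝ :=
  deriv (fun s : ℝ => g (hMul x (hExp (s • v)))) 0

lemma nhds_of_hDist {z : Heis} {U : Set Heis} (hU : U ∈ 𝓝 z) :
    ∃ η > 0, ∀ z', hDist z z' ≤ η → z' ∈ U := by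
  obtain ⟨V, hVU, hV, hz⟩ := mem_nhds_iff.1 hU
  obtain ⟨η, hη, h⟩ := (isOpen_iff_hDist V).1 hV z hz
  exact ⟨η / 2, by positivity, fun z' hz' => hVU (h z' (by linarith))⟩

lemma continuous_of_hDist {E : Type*} [NormedAddCommGroup E] {f : Heis → E} {L : ℝ}
    (hf : ∀ x y, ‖f x - f y‖ ≤ L * hDist x y) : Continuous f := by
  refine continuous_iff_continuousAt.2 fun x => ?_
  rw [ContinuousAt, tendsto_iff_norm_sub_tendsto_zero]
  have h : Tendsto (fun y => L * hDist y x) (𝓝 x) (𝓝 (L * hDist x x)) :=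
    ((continuous_hDist.comp (Continuous.prodMk_left x)).const_mul L).tendsto x
  rw [hDist_self, mul_zero] at h
  exact squeeze_zero (fun _ => norm_nonneg _) (fun y => hf y x) h

section Scalar

variable {g : Heis → ℝ} {L : ℝ} (hg : ∀ x y, |g x - g y| ≤ L * hDist x y)
include hg

lemma lipschitz_line (hL : 0 ≤ L) (x : Heis) (v : ℝ × ℝ) :
    LipschitzWith (Real.toNNReal (L * hDist 0 (hExp v))) fun s : ℝ => g (hMul x (hExp (s • v))) := by
  have h0 := mul_nonneg hL (hDist_nonneg 0 (hExp v))
  refine LipschitzWith.of_dist_le_mul fun s t => ?_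
  rw [Real.dist_eq, Real.dist_eq, Real.coe_toNNReal _ h0]
  refine (hg _ _).trans_eq ?_
  rw [hDist_hMul_hExp_smul_smul, abs_sub_comm]
  ring

lemma abs_derivH_le (hL : 0 ≤ L) (v : ℝ × ℝ) (x : Heis) :
    |derivH g v x| ≤ L * hDist 0 (hExp v) := by
  have h0 := mul_nonneg hL (hDist_nonneg 0 (hExp v))
  have := norm_deriv_le_of_lipschitz (lipschitz_line hg hL x v) (x₀ := 0)
  rwa [Real.coe_toNNReal _ h0] at this

lemma measurable_derivH (v : ℝ × ℝ) : Measurable (derivH g v) := by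
  have hc : Continuous g := continuous_of_hDist hg
  have h1 : Continuous (Function.uncurry fun (x : Heis) (s : ℝ) => g (hMul x (hExp (s • v)))) :=
    hc.comp (continuous_hMul.comp (continuous_fst.prodMk
      (continuous_hExp.comp (continuous_snd.smul continuous_const))))
  exact (measurable_deriv_with_param h1).comp (measurable_id.prodMk measurable_const)

omit hg in
lemma hMul_dil_hExp (x z : Heis) (l s : ℝ) (v : ℝ × ℝ) :
    hMul x (dil l (hMul z (hExp (s • v)))) = hMul (hMul x (dil l z)) (hExp ((l * s) • v)) := by
  rw [dil_hMul, dil_hExp, hMul_assoc, smul_smul]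

omit hg in
lemma deriv_line (x : Heis) (v : ℝ × ℝ) (s : ℝ) :
    deriv (fun s : ℝ => g (hMul x (hExp (s • v)))) s
      = derivH g v (hMul x (hExp (s • v))) := by
  have h := deriv_comp_const_add (f := fun s : ℝ => g (hMul x (hExp (s • v)))) (a := s) (x := 0)
  rw [add_zero] at h
  rw [← h, derivH]
  simp only [hMul_assoc, hExp_add_smul]

omit hg in
lemma continuous_segment (x z : Heis) (l : ℝ) (v : ℝ × ℝ) :
    Continuous fun s : ℝ => hMul x (dil l (hMul z (hExp (s • v)))) := by
  have h1 : Continuous fun s : ℝ => hExp (s • v) :=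
    continuous_hExp.comp (continuous_id.smul continuous_const)
  have h2 : Continuous fun s : ℝ => hMul z (hExp (s • v)) :=
    continuous_hMul.comp (continuous_const.prodMk h1)
  exact continuous_hMul.comp (continuous_const.prodMk
    (continuous_dil.comp (continuous_const.prodMk h2)))

lemma sub_eq_integral_derivH (hL : 0 ≤ L) (x z : Heis) {l : ℝ} (hl : 0 < l) (t : ℝ) (v : ℝ × ℝ) :
    l⁻¹ * (g (hMul x (dil l (hMul z (hExp (t • v))))) - g (hMul x (dil l z)))
      = t * ∫ s in (0 : ℝ)..1, derivH g v (hMul x (dil l (hMul z (hExp (s • t • v))))) := by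
  set w := hMul x (dil l z)
  have e : ∀ s : ℝ, hMul x (dil l (hMul z (hExp (s • t • v)))) = hMul w (hExp ((l * t * s) • v)) :=
    fun s => by rw [smul_smul, hMul_dil_hExp]; congr 3; ring
  have e1 : hMul x (dil l (hMul z (hExp (t • v)))) = hMul w (hExp ((l * t) • v)) :=
    hMul_dil_hExp _ _ _ _ _
  have hlip := (lipschitz_line hg hL w v).lipschitzOnWith (s := uIcc 0 (l * t))
  have hint := hlip.absolutelyContinuousOnInterval.integral_deriv_eq_sub
  simp only [deriv_line] at hint
  have h0 : hMul w (hExp ((0 : ℝ) • v)) = w := by simp [hMul, hExp]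
  rw [h0] at hint
  rw [e1, ← hint]
  simp only [e]
  have := intervalIntegral.mul_integral_comp_mul_left (a := 0) (b := 1)
    (f := fun s => derivH g v (hMul w (hExp (s • v)))) (c := l * t)
  rw [mul_zero, mul_one] at this
  rw [← this]
  field_simp

omit hg in
lemma intervalIntegrable_of_bounded {ψ : ℝ → ℝ} (hψ : Measurable ψ) {C : ℝ} (hC : ∀ s, |ψ s| ≤ C)
    (a b : ℝ) : IntervalIntegrable ψ volume a b := by
  exact (intervalIntegrable_const (c := C)).mono_fun hψ.aestronglyMeasurable
    (ae_of_all _ fun s => (hC s).trans (le_abs_self C))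

/-- Rescaled differences of `g` along horizontal segments converge at Lebesgue points of the
directional derivative. -/
lemma tendsto_of_isHLebesguePoint (hL : 0 ≤ L) {v : ℝ × ℝ} {x : Heis}
    (hx : IsHLebesguePoint (derivH g v) x) (z : Heis) (t : ℝ) :
    Tendsto (fun l : ℝ => l⁻¹ * (g (hMul x (dil l (hMul z (hExp (t • v)))))
      - g (hMul x (dil l z)))) (𝓝[>] 0) (𝓝 (t * derivH g v x)) := by
  rw [Metric.tendsto_nhds]
  intro ε hε
  have hquot : ∀ l > 0, ∀ a b : Heis,
      |l⁻¹ * (g (hMul x (dil l a)) - g (hMul x (dil l b)))| ≤ L * hDist a b := fun l hl a b => by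
    rw [abs_mul, abs_of_pos (inv_pos.2 hl), inv_mul_le_iff₀ hl]
    refine (hg _ _).trans_eq ?_
    rw [hDist_hMul_left, hDist_dil, abs_of_pos hl]
    ring
  have hε' : 0 < ε / (4 * (L + 1)) := by positivity
  obtain ⟨η₀, hη₀, hη⟩ : ∃ η > 0, ∀ z', hDist z z' ≤ η →
      hDist (hMul z (hExp (t • v))) (hMul z' (hExp (t • v))) < ε / (4 * (L + 1)) := by
    refine nhds_of_hDist (ContinuousAt.eventually_lt (f := fun z' =>
      hDist (hMul z (hExp (t • v))) (hMul z' (hExp (t • v)))) ?_ continuousAt_const ?_)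
    · exact (continuous_hDist.comp (continuous_const.prodMk
        (continuous_hMul.comp (continuous_id.prodMk continuous_const)))).continuousAt
    · rwa [hDist_self]
  have hηm : 0 < min η₀ (ε / (4 * (L + 1))) := lt_min hη₀ hε'
  have hδ : 0 < ε / (4 * (|t| + 1)) := by positivity
  filter_upwards [hx.exists_segment (measurable_derivH hg v) z (t • v) hηm
    (ENNReal.ofReal_pos.2 hδ), self_mem_nhdsWithin] with l ⟨z', hz', hint⟩ hl
  have hl : 0 < l := hl
  have h1 := hquot l hl (hMul z (hExp (t • v))) (hMul z' (hExp (t • v)))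
  have h2 := hquot l hl z' z
  have h3 := sub_eq_integral_derivH hg hL x z' hl t v
  have hI : IntervalIntegrable
      (fun s : ℝ => derivH g v (hMul x (dil l (hMul z' (hExp (s • t • v)))))) volume 0 1 :=
    intervalIntegrable_of_bounded ((measurable_derivH hg v).comp
      (continuous_segment x z' l (t • v)).measurable) (fun s => abs_derivH_le hg hL v _) 0 1
  have h4 : |(∫ s in (0 : ℝ)..1, derivH g v (hMul x (dil l (hMul z' (hExp (s • t • v))))))
      - derivH g v x| ≤ ε / (4 * (|t| + 1)) := by
    have e : (∫ s in (0 : ℝ)..1, derivH g v (hMul x (dil l (hMul z' (hExp (s • t • v))))))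
        - derivH g v x = ∫ s in (0 : ℝ)..1,
          (derivH g v (hMul x (dil l (hMul z' (hExp (s • t • v))))) - derivH g v x) := by
      rw [intervalIntegral.integral_sub hI intervalIntegrable_const]
      simp
    rw [e, intervalIntegral.integral_of_le zero_le_one, ← Real.norm_eq_abs, ← toReal_enorm]
    exact ENNReal.toReal_le_of_le_ofReal hδ.le ((enorm_integral_le_lintegral_enorm _).trans hint)
  have hLε : L * (ε / (4 * (L + 1))) ≤ ε / 4 := by
    rw [← mul_div_assoc, div_le_div_iff₀ (by positivity) (by positivity)]; nlinarith
  have htε : |t| * (ε / (4 * (|t| + 1))) ≤ ε / 4 := by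
    have := abs_nonneg t
    rw [← mul_div_assoc, div_le_div_iff₀ (by positivity) (by positivity)]; nlinarith
  have h1' := h1.trans ((mul_le_mul_of_nonneg_left
    (hη z' (hz'.trans (min_le_left _ _))).le hL).trans hLε)
  have h2' := h2.trans ((mul_le_mul_of_nonneg_left
    ((hDist_comm z' z).trans_le (hz'.trans (min_le_right _ _))) hL).trans hLε)
  have h5 : |t * (∫ s in (0 : ℝ)..1, derivH g v (hMul x (dil l (hMul z' (hExp (s • t • v))))))
      - t * derivH g v x| ≤ ε / 4 := by
    rw [← mul_sub, abs_mul]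
    exact (mul_le_mul_of_nonneg_left h4 (abs_nonneg t)).trans htε
  rw [← h3] at h5
  rw [Real.dist_eq]
  set A := g (hMul x (dil l (hMul z (hExp (t • v)))))
  set A' := g (hMul x (dil l (hMul z' (hExp (t • v)))))
  set B := g (hMul x (dil l z))
  set B' := g (hMul x (dil l z'))
  have : l⁻¹ * (A - B) - t * derivH g v x = l⁻¹ * (A - A') + l⁻¹ * (B' - B)
    + (l⁻¹ * (A' - B') - t * derivH g v x) := by ring
  rw [this]
  refine (abs_add_three _ _ _).trans_lt ?_
  linarith

lemma tendsto_quotient (hL : 0 ≤ L) {x : Heis} (h1 : IsHLebesguePoint (derivH g (1, 0)) x)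
    (h2 : IsHLebesguePoint (derivH g (0, 1)) x) (z : Heis) (v : ℝ × ℝ) :
    Tendsto (fun l : ℝ => l⁻¹ * (g (hMul x (dil l (hMul z (hExp v)))) - g (hMul x (dil l z))))
      (𝓝[>] 0) (𝓝 (v.1 * derivH g (1, 0) x + v.2 * derivH g (0, 1) x)) := by
  set z₁ := hMul z (hExp ((v.1 / 2) • (1, 0)))
  set z₂ := hMul z₁ (hExp (v.2 • (0, 1)))
  have e : hMul z (hExp v) = hMul z₂ (hExp ((v.1 / 2) • (1, 0))) := by
    simp only [z₂, z₁, hMul_assoc]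
    congr 1
    ext <;> simp [hMul, hExp]
    ring
  have t1 := tendsto_of_isHLebesguePoint hg hL h1 z (v.1 / 2)
  have t2 := tendsto_of_isHLebesguePoint hg hL h2 z₁ v.2
  have t3 := tendsto_of_isHLebesguePoint hg hL h1 z₂ (v.1 / 2)
  have := (t1.add t2).add t3
  rw [e]
  convert this using 2
  · ring
  · ring

lemma derivH_eq (hL : 0 ≤ L) {x : Heis} (h1 : IsHLebesguePoint (derivH g (1, 0)) x)
    (h2 : IsHLebesguePoint (derivH g (0, 1)) x) (v : ℝ × ℝ) :
    derivH g v x = v.1 * derivH g (1, 0) x + v.2 * derivH g (0, 1) x := by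
  have key : ∀ (l : ℝ) (v : ℝ × ℝ), hMul x (dil l (hMul 0 (hExp v))) = hMul x (hExp (l • v)) :=
    fun l v => by rw [← dil_hExp]; congr 2; simp [hMul]
  have key0 : ∀ l : ℝ, hMul x (dil l 0) = x := fun l => by simp [hMul, dil]
  have t1 := tendsto_quotient hg hL h1 h2 0 v
  have t2 := (tendsto_quotient hg hL h1 h2 0 (-v)).neg
  simp only [key, key0] at t1 t2
  have h0 : hMul x (hExp ((0 : ℝ) • v)) = x := by simp [hMul, hExp]
  refine HasDerivAt.deriv (hasDerivAt_iff_tendsto_slope_zero.2 ?_)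
  rw [← nhdsLT_sup_nhdsGT, tendsto_sup]
  simp only [zero_add, h0, smul_eq_mul]
  refine ⟨?_, t1⟩
  have hneg : Tendsto (fun t : ℝ => -t) (𝓝[<] 0) (𝓝[>] 0) := by
    simpa using tendsto_neg_nhdsLT (a := (0 : ℝ))
  convert t2.comp hneg using 2
  · simp [inv_neg]
  · simp; ring

end Scalar

lemma exists_rat_hExp_near (L : ℝ) (z : Heis) (v : ℝ × ℝ) {ε : ℝ} (hε : 0 < ε) :
    ∃ q : ℚ × ℚ, L * hDist (hMul z (hExp v)) (hMul z (hExp (q.1, q.2))) < ε ∧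
      L * hDist 0 (hExp (((q.1 : ℝ), (q.2 : ℝ)) - v)) < ε := by
  have hd : DenseRange fun q : ℚ × ℚ => ((q.1 : ℝ), (q.2 : ℝ)) :=
    (Rat.denseRange_cast (𝕜 := ℝ)).prodMap (Rat.denseRange_cast (𝕜 := ℝ))
  have hc1 : Continuous fun w : ℝ × ℝ => L * hDist (hMul z (hExp v)) (hMul z (hExp w)) :=
    (continuous_hDist.comp (continuous_const.prodMk (continuous_hMul.comp
      (continuous_const.prodMk continuous_hExp)))).const_mul L
  have hc2 : Continuous fun w : ℝ × ℝ => L * hDist 0 (hExp (w - v)) :=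
    (continuous_hDist.comp (continuous_const.prodMk (continuous_hExp.comp
      (continuous_id.sub continuous_const)))).const_mul L
  have hmem : {w : ℝ × ℝ | L * hDist (hMul z (hExp v)) (hMul z (hExp w)) < ε ∧
      L * hDist 0 (hExp (w - v)) < ε} ∈ 𝓝 v := by
    refine (hc1.continuousAt.eventually_lt continuousAt_const ?_).and
      (hc2.continuousAt.eventually_lt continuousAt_const ?_)
    · simpa [hDist_self] using hε
    · simpa [hDist, hExp] using hε
  obtain ⟨_, hq, ⟨q, rfl⟩⟩ := mem_closure_iff_nhds.1 (hd v) _ hmem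
  exact ⟨q, hq⟩

section Blowup

variable {E : Type*} [NormedAddCommGroup E] [NormedSpace ℝ E] (F : SignFamily E)

/-- The speed of `f` in direction `v`, recovered from the functionals of a sign family. -/
def SignFamily.speed (f : Heis → E) (v : ℝ × ℝ) (x : Heis) : ℝ :=
  ⨆ n, ∑ σ ∈ F.I n, |derivH (fun y => F.T n σ (f y)) v x|

/-- The rescalings of `f` at `x` have gradients `G`, and speed at most the seminorm `N`, which is
the limit of the total size of the gradients. -/
structure SignFamily.IsBlowup (f : Heis → E) (x : Heis) (G : ℕ → Finset ℕ → ℝ × ℝ)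
    (N : Seminorm ℝ (ℝ × ℝ)) : Prop where
  tendsto : ∀ n σ z v, Tendsto (fun l : ℝ =>
    l⁻¹ * F.T n σ (f (hMul x (dil l (hMul z (hExp v)))) - f (hMul x (dil l z)))) (𝓝[>] 0)
      (𝓝 (v.1 * (G n σ).1 + v.2 * (G n σ).2))
  le_add : ∀ z v, ∀ ε > 0, ∀ᶠ l in 𝓝[>] (0 : ℝ),
    l⁻¹ * ‖f (hMul x (dil l (hMul z (hExp v)))) - f (hMul x (dil l z))‖ ≤ N v + ε
  sum_le : ∀ n v, ∑ σ ∈ F.I n, |v.1 * (G n σ).1 + v.2 * (G n σ).2| ≤ N v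
  tendsto_sum : ∀ v, Tendsto (fun n => ∑ σ ∈ F.I n, |v.1 * (G n σ).1 + v.2 * (G n σ).2|) atTop
    (𝓝 (N v))

variable {f : Heis → E} {L : ℝ} (hf : ∀ x y, ‖f x - f y‖ ≤ L * hDist x y)
include hf

lemma SignFamily.abs_T_comp_sub_le (n : ℕ) (σ : Finset ℕ) (x y : Heis) :
    |F.T n σ (f x) - F.T n σ (f y)| ≤ L * hDist x y := by
  rw [← map_sub]
  exact ((F.abs_T_le n σ _).trans (F.M_le n σ _)).trans (hf x y)

lemma SignFamily.sum_abs_derivH_le (n : ℕ) (v : ℝ × ℝ) (x : Heis) :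
    ∑ σ ∈ F.I n, |derivH (fun y => F.T n σ (f y)) v x| ≤ L * hDist 0 (hExp v) := by
  classical
  set φ : Finset ℕ → ℝ → ℝ := fun σ s => F.T n σ (f (hMul x (hExp (s • v)))) with hφ
  set S := (F.I n).filter fun σ => DifferentiableAt ℝ (φ σ) 0
  have hS : ∑ σ ∈ F.I n, |derivH (fun y => F.T n σ (f y)) v x| = ∑ σ ∈ S, |deriv (φ σ) 0| := by
    rw [Finset.sum_filter_of_ne]
    · rfl
    · intro σ _ h
      by_contra hd
      exact h (by rw [deriv_zero_of_not_differentiableAt hd, abs_zero])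
  rw [hS]
  have ht : Tendsto (fun t : ℝ => ∑ σ ∈ S, |t⁻¹ • (φ σ (0 + t) - φ σ 0)|) (𝓝[≠] 0)
      (𝓝 (∑ σ ∈ S, |deriv (φ σ) 0|)) :=
    tendsto_finsetSum _ fun σ hσ =>
      (hasDerivAt_iff_tendsto_slope_zero.1 (Finset.mem_filter.1 hσ).2.hasDerivAt).abs
  refine le_of_tendsto ht ?_
  filter_upwards [self_mem_nhdsWithin] with t ht
  have ht : 0 < |t| := abs_pos.2 ht
  calc ∑ σ ∈ S, |t⁻¹ • (φ σ (0 + t) - φ σ 0)|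
      ≤ ∑ σ ∈ F.I n, |t⁻¹ • (φ σ (0 + t) - φ σ 0)| :=
        Finset.sum_le_sum_of_subset_of_nonneg (Finset.filter_subset _ _) fun _ _ _ => abs_nonneg _
    _ = |t|⁻¹ * ∑ σ ∈ F.I n, |F.T n σ (f (hMul x (hExp (t • v))) - f x)| := by
        rw [Finset.mul_sum]
        refine Finset.sum_congr rfl fun σ _ => ?_
        have h0 : hMul x (hExp ((0 : ℝ) • v)) = x := by simp [hMul, hExp]
        simp only [hφ, h0, zero_add, smul_eq_mul, abs_mul, abs_inv, map_sub]
    _ ≤ |t|⁻¹ * (L * (|t| * hDist 0 (hExp v))) := by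
        gcongr
        refine (F.sum_abs_T_le n _).trans ?_
        rw [norm_sub_rev, ← hDist_hMul_hExp_smul x t v]
        exact hf _ _
    _ = L * hDist 0 (hExp v) := by field_simp

lemma SignFamily.bddAbove_speed (v : ℝ × ℝ) (x : Heis) :
    BddAbove (range fun n => ∑ σ ∈ F.I n, |derivH (fun y => F.T n σ (f y)) v x|) :=
  ⟨L * hDist 0 (hExp v), by rintro _ ⟨n, rfl⟩; exact F.sum_abs_derivH_le hf n v x⟩

lemma SignFamily.speed_le (v : ℝ × ℝ) (x : Heis) :
    F.speed f v x ≤ L * hDist 0 (hExp v) :=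
  ciSup_le fun n => F.sum_abs_derivH_le hf n v x

lemma SignFamily.abs_speed_le (v : ℝ × ℝ) (x : Heis) :
    |F.speed f v x| ≤ L * hDist 0 (hExp v) := by
  rw [abs_of_nonneg]
  · exact F.speed_le hf v x
  · exact Real.iSup_nonneg fun n => Finset.sum_nonneg fun _ _ => abs_nonneg _

lemma SignFamily.measurable_speed (v : ℝ × ℝ) : Measurable (F.speed f v) := by
  refine Measurable.iSup fun n => Finset.measurable_fun_sum _ fun σ _ => ?_
  exact (measurable_derivH (F.abs_T_comp_sub_le hf n σ) v).abs

lemma SignFamily.norm_sub_le_integral_speed (hL : 0 ≤ L) (hN : F.Norming f) (x z : Heis) {l : ℝ}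
    (hl : 0 < l) (v : ℝ × ℝ) :
    l⁻¹ * ‖f (hMul x (dil l (hMul z (hExp v)))) - f (hMul x (dil l z))‖
      ≤ ∫ s in (0 : ℝ)..1, F.speed f v (hMul x (dil l (hMul z (hExp (s • v))))) := by
  refine le_of_forall_pos_le_add fun ε hε => ?_
  obtain ⟨n, hn⟩ := hN (hMul x (dil l (hMul z (hExp v)))) (hMul x (dil l z)) (l * ε)
    (by positivity)
  have hi : ∀ σ, IntervalIntegrable (fun s : ℝ => derivH (fun y => F.T n σ (f y)) v
      (hMul x (dil l (hMul z (hExp (s • v)))))) volume 0 1 := fun σ =>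
    intervalIntegrable_of_bounded ((measurable_derivH (F.abs_T_comp_sub_le hf n σ) v).comp
      (continuous_segment x z l v).measurable)
      (fun s => abs_derivH_le (F.abs_T_comp_sub_le hf n σ) hL v _) 0 1
  have hi' := intervalIntegrable_of_bounded ((F.measurable_speed hf v).comp
      (continuous_segment x z l v).measurable) (fun s => F.abs_speed_le hf v _) 0 1
  calc l⁻¹ * ‖f (hMul x (dil l (hMul z (hExp v)))) - f (hMul x (dil l z))‖
      ≤ l⁻¹ * (∑ σ ∈ F.I n, |F.T n σ (f (hMul x (dil l (hMul z (hExp v))))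
        - f (hMul x (dil l z)))| + l * ε) := by gcongr
    _ = ∑ σ ∈ F.I n, |∫ s in (0 : ℝ)..1, derivH (fun y => F.T n σ (f y)) v
          (hMul x (dil l (hMul z (hExp (s • v)))))| + ε := by
        rw [mul_add, inv_mul_cancel_left₀ hl.ne', Finset.mul_sum]
        congr 1
        refine Finset.sum_congr rfl fun σ _ => ?_
        have := sub_eq_integral_derivH (F.abs_T_comp_sub_le hf n σ) hL x z hl 1 v
        rw [one_smul, one_mul] at this
        rw [← this, map_sub, abs_mul, abs_of_pos (inv_pos.2 hl)]
    _ ≤ ∑ σ ∈ F.I n, (∫ s in (0 : ℝ)..1, |derivH (fun y => F.T n σ (f y)) v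
          (hMul x (dil l (hMul z (hExp (s • v)))))|) + ε := by
        gcongr
        exact intervalIntegral.abs_integral_le_integral_abs zero_le_one
    _ = (∫ s in (0 : ℝ)..1, ∑ σ ∈ F.I n, |derivH (fun y => F.T n σ (f y)) v
          (hMul x (dil l (hMul z (hExp (s • v)))))|) + ε := by
        rw [intervalIntegral.integral_finsetSum fun σ _ => (hi σ).abs]
    _ ≤ _ := by
        gcongr
        refine intervalIntegral.integral_mono_on zero_le_one ?_ hi' fun s _ => ?_
        · simpa only [Finset.sum_fn] using
            IntervalIntegrable.sum (F.I n) fun σ _ => (hi σ).abs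
        · exact le_ciSup (F.bddAbove_speed hf v _) n

omit [NormedSpace ℝ E] in
lemma inv_mul_norm_sub_le (x : Heis) {l : ℝ} (hl : 0 < l) (a b : Heis) :
    l⁻¹ * ‖f (hMul x (dil l a)) - f (hMul x (dil l b))‖ ≤ L * hDist a b := by
  rw [inv_mul_le_iff₀ hl]
  refine (hf _ _).trans_eq ?_
  rw [hDist_hMul_left, hDist_dil, abs_of_pos hl]
  ring

lemma SignFamily.eventually_le_speed_add (hL : 0 ≤ L) (hN : F.Norming f) {x : Heis} {v : ℝ × ℝ}
    (hx : IsHLebesguePoint (F.speed f v) x) (z : Heis) {ε : ℝ} (hε : 0 < ε) :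
    ∀ᶠ l in 𝓝[>] (0 : ℝ),
      l⁻¹ * ‖f (hMul x (dil l (hMul z (hExp v)))) - f (hMul x (dil l z))‖
        ≤ F.speed f v x + ε := by
  have hε' : 0 < ε / (4 * (L + 1)) := by positivity
  obtain ⟨η₀, hη₀, hη⟩ : ∃ η > 0, ∀ z', hDist z z' ≤ η →
      hDist (hMul z (hExp v)) (hMul z' (hExp v)) < ε / (4 * (L + 1)) := by
    refine nhds_of_hDist (ContinuousAt.eventually_lt (f := fun z' =>
      hDist (hMul z (hExp v)) (hMul z' (hExp v))) ?_ continuousAt_const ?_)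
    · exact (continuous_hDist.comp (continuous_const.prodMk
        (continuous_hMul.comp (continuous_id.prodMk continuous_const)))).continuousAt
    · rwa [hDist_self]
  have hηm : 0 < min η₀ (ε / (4 * (L + 1))) := lt_min hη₀ hε'
  have hδ : 0 < ε / 4 := by positivity
  filter_upwards [hx.exists_segment (F.measurable_speed hf v) z v hηm
    (ENNReal.ofReal_pos.2 hδ), self_mem_nhdsWithin] with l ⟨z', hz', hint⟩ hl
  have hl : 0 < l := hl
  have h1 := inv_mul_norm_sub_le hf x hl (hMul z (hExp v)) (hMul z' (hExp v))
  have h2 := inv_mul_norm_sub_le hf x hl z' z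
  have h3 := F.norm_sub_le_integral_speed hf hL hN x z' hl v
  have hI : IntervalIntegrable
      (fun s : ℝ => F.speed f v (hMul x (dil l (hMul z' (hExp (s • v)))))) volume 0 1 :=
    intervalIntegrable_of_bounded ((F.measurable_speed hf v).comp
      (continuous_segment x z' l v).measurable) (fun s => F.abs_speed_le hf v _) 0 1
  have h4 : |(∫ s in (0 : ℝ)..1, F.speed f v (hMul x (dil l (hMul z' (hExp (s • v))))))
      - F.speed f v x| ≤ ε / 4 := by
    have e : (∫ s in (0 : ℝ)..1, F.speed f v (hMul x (dil l (hMul z' (hExp (s • v))))))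
        - F.speed f v x = ∫ s in (0 : ℝ)..1,
          (F.speed f v (hMul x (dil l (hMul z' (hExp (s • v))))) - F.speed f v x) := by
      rw [intervalIntegral.integral_sub hI intervalIntegrable_const]
      simp
    rw [e, intervalIntegral.integral_of_le zero_le_one, ← Real.norm_eq_abs, ← toReal_enorm]
    exact ENNReal.toReal_le_of_le_ofReal hδ.le ((enorm_integral_le_lintegral_enorm _).trans hint)
  have hLε : L * (ε / (4 * (L + 1))) ≤ ε / 4 := by
    rw [← mul_div_assoc, div_le_div_iff₀ (by positivity) (by positivity)]; nlinarith
  have h1' := h1.trans ((mul_le_mul_of_nonneg_left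
    (hη z' (hz'.trans (min_le_left _ _))).le hL).trans hLε)
  have h2' := h2.trans ((mul_le_mul_of_nonneg_left
    ((hDist_comm z' z).trans_le (hz'.trans (min_le_right _ _))) hL).trans hLε)
  have h4' := (abs_le.1 h4).2
  set A := f (hMul x (dil l (hMul z (hExp v))))
  set A' := f (hMul x (dil l (hMul z' (hExp v))))
  set B := f (hMul x (dil l z))
  set B' := f (hMul x (dil l z'))
  have : ‖A - B‖ ≤ ‖A - A'‖ + ‖A' - B'‖ + ‖B' - B‖ := by
    have := norm_add₃_le (a := A - A') (b := A' - B') (c := B' - B)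
    rwa [show A - A' + (A' - B') + (B' - B) = A - B by abel] at this
  have := mul_le_mul_of_nonneg_left this (inv_pos.2 hl).le
  linarith

lemma SignFamily.exists_isBlowup (hL : 0 ≤ L) (hN : F.Norming f) :
    ∀ᵐ x ∂(volume : Measure Heis), ∃ G N, F.IsBlowup f x G N := by
  have h1 : ∀ v : ℝ × ℝ, ∀ᵐ x ∂(volume : Measure Heis), ∀ n, ∀ σ : Finset ℕ,
      IsHLebesguePoint (derivH (fun y => F.T n σ (f y)) v) x := fun v => by
    refine ae_all_iff.2 fun n => ae_all_iff.2 fun σ => ?_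
    exact ae_isHLebesguePoint (measurable_derivH (F.abs_T_comp_sub_le hf n σ) v)
      (abs_derivH_le (F.abs_T_comp_sub_le hf n σ) hL v)
  have h2 : ∀ᵐ x ∂(volume : Measure Heis), ∀ q : ℚ × ℚ,
      IsHLebesguePoint (F.speed f ((q.1 : ℝ), (q.2 : ℝ))) x :=
    ae_all_iff.2 fun q => ae_isHLebesguePoint (F.measurable_speed hf _) (F.abs_speed_le hf _)
  filter_upwards [h1 (1, 0), h1 (0, 1), h2] with x hx1 hx2 hx3
  set G : ℕ → Finset ℕ → ℝ × ℝ := fun n σ =>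
    (derivH (fun y => F.T n σ (f y)) (1, 0) x, derivH (fun y => F.T n σ (f y)) (0, 1) x)
  have hG : ∀ n σ (v : ℝ × ℝ),
      derivH (fun y => F.T n σ (f y)) v x = v.1 * (G n σ).1 + v.2 * (G n σ).2 := fun n σ v =>
    derivH_eq (F.abs_T_comp_sub_le hf n σ) hL (hx1 n σ) (hx2 n σ) v
  have hbdd : ∀ v : ℝ × ℝ, BddAbove (range fun n =>
      ∑ σ ∈ F.I n, |v.1 * (G n σ).1 + v.2 * (G n σ).2|) := fun v => by
    simpa only [hG] using F.bddAbove_speed hf v x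
  set N : Seminorm ℝ (ℝ × ℝ) := Seminorm.of
    (fun v => ⨆ n, ∑ σ ∈ F.I n, |v.1 * (G n σ).1 + v.2 * (G n σ).2|)
    (fun v w => ciSup_le fun n => by
      refine le_trans ?_ (add_le_add (le_ciSup (hbdd v) n) (le_ciSup (hbdd w) n))
      rw [← Finset.sum_add_distrib]
      refine Finset.sum_le_sum fun σ _ => ?_
      refine le_trans (le_of_eq ?_) (abs_add_le _ _)
      simp only [Prod.fst_add, Prod.snd_add]
      congr 1
      ring)
    (fun a v => by
      rw [Real.mul_iSup_of_nonneg (norm_nonneg a)]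
      refine iSup_congr fun n => ?_
      rw [Finset.mul_sum]
      refine Finset.sum_congr rfl fun σ _ => ?_
      rw [Real.norm_eq_abs, ← abs_mul]
      simp only [Prod.smul_fst, Prod.smul_snd, smul_eq_mul]
      congr 1
      ring)
  have hNv : ∀ v : ℝ × ℝ, N v = ⨆ n, ∑ σ ∈ F.I n, |v.1 * (G n σ).1 + v.2 * (G n σ).2| :=
    fun v => rfl
  have hNs : ∀ v : ℝ × ℝ, N v = F.speed f v x := fun v => by
    rw [hNv, SignFamily.speed]
    simp only [hG]
  have ht : ∀ n σ z (v : ℝ × ℝ), Tendsto (fun l : ℝ =>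
      l⁻¹ * F.T n σ (f (hMul x (dil l (hMul z (hExp v)))) - f (hMul x (dil l z)))) (𝓝[>] 0)
      (𝓝 (v.1 * (G n σ).1 + v.2 * (G n σ).2)) := fun n σ z v => by
    simp only [map_sub]
    exact tendsto_quotient (F.abs_T_comp_sub_le hf n σ) hL (hx1 n σ) (hx2 n σ) z v
  refine ⟨G, N, ht, fun z v ε hε => ?_, fun n v => le_ciSup (hbdd v) n, fun v => ?_⟩
  · obtain ⟨q, hq1, hq2⟩ := exists_rat_hExp_near L z v (ε := ε / 3) (by positivity)
    have hq3 : N (q.1, q.2) ≤ N v + ε / 3 := by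
      have h : N (((q.1 : ℝ), (q.2 : ℝ)) - v) ≤ ε / 3 := by
        rw [hNs]; exact (F.speed_le hf _ x).trans hq2.le
      have := map_add_le_add N v (((q.1 : ℝ), (q.2 : ℝ)) - v)
      rw [add_sub_cancel] at this
      linarith
    filter_upwards [F.eventually_le_speed_add hf hL hN (hx3 q) z (ε := ε / 3) (by positivity),
      self_mem_nhdsWithin] with l h hl
    have hl : 0 < l := hl
    have h1 := inv_mul_norm_sub_le hf x hl (hMul z (hExp v)) (hMul z (hExp (q.1, q.2)))
    rw [← hNs] at h
    have := norm_sub_le_norm_sub_add_norm_sub (f (hMul x (dil l (hMul z (hExp v)))))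
      (f (hMul x (dil l (hMul z (hExp (q.1, q.2)))))) (f (hMul x (dil l z)))
    have := mul_le_mul_of_nonneg_left this (inv_pos.2 hl).le
    linarith
  · refine tendsto_atTop_ciSup (monotone_nat_of_le_succ fun n => ?_) (hbdd v)
    refine le_of_tendsto_of_tendsto (tendsto_finsetSum _ fun σ _ => (ht n σ 0 v).abs)
      (tendsto_finsetSum _ fun σ _ => (ht (n + 1) σ 0 v).abs) (Eventually.of_forall fun l => ?_)
    simp only [abs_mul, ← Finset.mul_sum]
    exact mul_le_mul_of_nonneg_left (F.sum_abs_T_mono _ n.le_succ) (abs_nonneg _)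

end Blowup

lemma exists_finset_directions {η : ℝ} (hη : 0 < η) : ∃ D : Finset ((ℝ × ℝ) × (ℝ × ℝ)),
    ∀ g : ℝ × ℝ, ∃ d ∈ D, d.1.1 * d.2.2 - d.1.2 * d.2.1 = 1 ∧
      |d.1.1 * g.1 + d.1.2 * g.2| ≤ η * (|g.1| + |g.2|) ∧
      |d.2.1 * g.1 + d.2.2 * g.2| ≤ |g.1| + |g.2| := by
  classical
  obtain ⟨t, -, ht, hcov⟩ := (isCompact_Icc (a := (-1 : ℝ)) (b := 1)).finite_cover_balls hη
  have hnear : ∀ a b : ℝ, |a| ≤ |b| → ∃ c ∈ t, |c * b - a| ≤ η * |b| := by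
    intro a b hab
    have hmem : a / b ∈ Icc (-1 : ℝ) 1 := by
      rw [Set.mem_Icc, ← abs_le, abs_div]
      exact div_le_one_of_le₀ hab (abs_nonneg b)
    obtain ⟨c, hc, hd⟩ := mem_iUnion₂.1 (hcov hmem)
    rw [Metric.mem_ball, Real.dist_eq, abs_sub_comm] at hd
    refine ⟨c, hc, ?_⟩
    rcases eq_or_ne b 0 with rfl | hb
    · simpa using hab
    · rw [show c * b - a = (c - a / b) * b by field_simp, abs_mul]
      gcongr
  refine ⟨ht.toFinset.image (fun c => ((c, -1), (1, 0))) ∪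
    ht.toFinset.image (fun c => ((1, -c), (0, 1))), fun g => ?_⟩
  have h1 := abs_nonneg g.1
  have h2 := abs_nonneg g.2
  rcases le_total |g.2| |g.1| with h | h
  · obtain ⟨c, hc, hd⟩ := hnear _ _ h
    refine ⟨((c, -1), (1, 0)), Finset.mem_union_left _
      (Finset.mem_image_of_mem _ (ht.mem_toFinset.2 hc)), by norm_num, ?_, ?_⟩
    · rw [show c * g.1 + -1 * g.2 = c * g.1 - g.2 by ring]
      nlinarith
    · simp
  · obtain ⟨c, hc, hd⟩ := hnear _ _ h
    refine ⟨((1, -c), (0, 1)), Finset.mem_union_right _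
      (Finset.mem_image_of_mem _ (ht.mem_toFinset.2 hc)), by norm_num, ?_, ?_⟩
    · rw [show 1 * g.1 + -c * g.2 = -(c * g.2 - g.1) by ring, abs_neg]
      nlinarith
    · simp

lemma hMul_commutator (z : Heis) (s r : ℝ) (v w : ℝ × ℝ) :
    hMul (hMul (hMul (hMul z (hExp (s • v))) (hExp (r • w))) (hExp (-s • v))) (hExp (-r • w))
      = hMul z (0, 0, s * r * (v.1 * w.2 - v.2 * w.1)) := by
  simp only [hMul, hExp, Prod.smul_fst, Prod.smul_snd, smul_eq_mul, Prod.mk.injEq]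
  refine ⟨by ring, by ring, by ring⟩

/-- Compatible families of pseudometrics, each almost minimal among those with prescribed
gradients `G`, are small along the center. -/
lemma exists_sum_center_le {ι : Type*} {I : ℕ → Finset ι} {m : ℕ → ι → Heis → Heis → ℝ}
    {G : ℕ → ι → ℝ × ℝ} {N : Seminorm ℝ (ℝ × ℝ)}
    (htri : ∀ n σ a b c, m n σ a c ≤ m n σ a b + m n σ b c)
    (hge : ∀ n σ p (u : ℝ × ℝ), |u.1 * (G n σ).1 + u.2 * (G n σ).2| ≤ m n σ p (hMul p (hExp u)))
    (hle : ∀ n p u, ∑ σ ∈ I n, m n σ p (hMul p (hExp u)) ≤ N u)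
    (hlim : ∀ u : ℝ × ℝ, Tendsto
      (fun n => ∑ σ ∈ I n, |u.1 * (G n σ).1 + u.2 * (G n σ).2|) atTop (𝓝 (N u)))
    (z : Heis) (h : ℝ) {ε : ℝ} (hε : 0 < ε) :
    ∃ n, ∑ σ ∈ I n, m n σ z (hMul z (0, 0, h)) ≤ ε := by
  set K := N (1, 0) + N (0, 1)
  have hK : 0 ≤ K := add_nonneg (apply_nonneg N _) (apply_nonneg N _)
  have hGK : ∀ n, ∑ σ ∈ I n, (|(G n σ).1| + |(G n σ).2|) ≤ K := fun n => by
    rw [Finset.sum_add_distrib]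
    refine add_le_add ((Finset.sum_le_sum fun σ _ => ?_).trans (hle n 0 (1, 0)))
      ((Finset.sum_le_sum fun σ _ => ?_).trans (hle n 0 (0, 1)))
    · simpa using hge n σ 0 (1, 0)
    · simpa using hge n σ 0 (0, 1)
  set r := ε / (6 * (K + 1)) with hr_def
  have hr : 0 < r := by positivity
  set s := h / r with hs_def
  set η := ε / (6 * (K + 1) * (|s| + 1)) with hη_def
  have hη : 0 < η := by positivity
  obtain ⟨D, hD⟩ := exists_finset_directions hη
  set Δ : ℕ → ι → Heis → ℝ × ℝ → ℝ := fun n σ p u =>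
    m n σ p (hMul p (hExp u)) - |u.1 * (G n σ).1 + u.2 * (G n σ).2| with hΔ_def
  have hΔ : ∀ n σ p u, 0 ≤ Δ n σ p u := fun n σ p u => sub_nonneg.2 (hge n σ p u)
  have hΔsum : ∀ n p u, ∑ σ ∈ I n, Δ n σ p u
      ≤ N u - ∑ σ ∈ I n, |u.1 * (G n σ).1 + u.2 * (G n σ).2| := fun n p u => by
    simp only [hΔ_def, Finset.sum_sub_distrib]
    linarith [hle n p u]
  have hΔlim : ∀ p u, Tendsto (fun n => ∑ σ ∈ I n, Δ n σ p u) atTop (𝓝 0) := fun p u => by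
    refine squeeze_zero (fun n => Finset.sum_nonneg fun σ _ => hΔ n σ p u)
      (fun n => hΔsum n p u) ?_
    simpa using (hlim u).const_sub (N u)
  set W : ℕ → ι → (ℝ × ℝ) × (ℝ × ℝ) → ℝ := fun n σ d =>
    Δ n σ z (s • d.1) + Δ n σ (hMul z (hExp (s • d.1))) (r • d.2)
      + Δ n σ (hMul (hMul z (hExp (s • d.1))) (hExp (r • d.2))) (-s • d.1)
      + Δ n σ (hMul (hMul (hMul z (hExp (s • d.1))) (hExp (r • d.2))) (hExp (-s • d.1)))
        (-r • d.2) with hW_def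
  have hW : ∀ n σ d, 0 ≤ W n σ d := fun n σ d =>
    add_nonneg (add_nonneg (add_nonneg (hΔ _ _ _ _) (hΔ _ _ _ _)) (hΔ _ _ _ _)) (hΔ _ _ _ _)
  have hWlim : Tendsto (fun n => ∑ d ∈ D, ∑ σ ∈ I n, W n σ d) atTop (𝓝 0) := by
    rw [show (0 : ℝ) = ∑ d ∈ D, (0 + 0 + 0 + 0) by simp]
    refine tendsto_finsetSum _ fun d _ => ?_
    simp only [hW_def, Finset.sum_add_distrib]
    exact (((hΔlim _ _).add (hΔlim _ _)).add (hΔlim _ _)).add (hΔlim _ _)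
  obtain ⟨n, hn⟩ := (hWlim.eventually_lt_const (show (0 : ℝ) < ε / 3 by positivity)).exists
  refine ⟨n, ?_⟩
  have hpt : ∀ σ, m n σ z (hMul z (0, 0, h))
      ≤ ∑ d ∈ D, W n σ d + (2 * |s| * η + 2 * r) * (|(G n σ).1| + |(G n σ).2|) := fun σ => by
    obtain ⟨d, hd, hd1, hd2, hd3⟩ := hD (G n σ)
    have hle' := Finset.single_le_sum (f := fun d => W n σ d) (fun d _ => hW n σ d) hd
    have hcomm := hMul_commutator z s r d.1 d.2
    rw [hd1, mul_one, hs_def, div_mul_cancel₀ _ hr.ne', ← hs_def] at hcomm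
    rw [← hcomm]
    have t1 := htri n σ z (hMul z (hExp (s • d.1)))
      (hMul (hMul (hMul (hMul z (hExp (s • d.1))) (hExp (r • d.2))) (hExp (-s • d.1)))
        (hExp (-r • d.2)))
    have t2 := htri n σ (hMul z (hExp (s • d.1)))
      (hMul (hMul z (hExp (s • d.1))) (hExp (r • d.2)))
      (hMul (hMul (hMul (hMul z (hExp (s • d.1))) (hExp (r • d.2))) (hExp (-s • d.1)))
        (hExp (-r • d.2)))
    have t3 := htri n σ (hMul (hMul z (hExp (s • d.1))) (hExp (r • d.2)))
      (hMul (hMul (hMul z (hExp (s • d.1))) (hExp (r • d.2))) (hExp (-s • d.1)))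
      (hMul (hMul (hMul (hMul z (hExp (s • d.1))) (hExp (r • d.2))) (hExp (-s • d.1)))
        (hExp (-r • d.2)))
    have hlin : ∀ (c : ℝ) (u : ℝ × ℝ), |(c • u).1 * (G n σ).1 + (c • u).2 * (G n σ).2|
        = |c| * |u.1 * (G n σ).1 + u.2 * (G n σ).2| := fun c u => by
      rw [← abs_mul]; congr 1; simp only [Prod.smul_fst, Prod.smul_snd, smul_eq_mul]; ring
    simp only [hW_def, hΔ_def, hlin, abs_neg, abs_of_pos hr] at hle'
    have hd2' := mul_le_mul_of_nonneg_left hd2 (abs_nonneg s)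
    have hd3' := mul_le_mul_of_nonneg_left hd3 hr.le
    simp only [hW_def, hΔ_def, hlin, abs_neg, abs_of_pos hr]
    linarith
  have hsη : 2 * |s| * η * K ≤ ε / 3 := by
    have h0 := abs_nonneg s
    rw [hη_def, mul_div_assoc', div_mul_eq_mul_div, div_le_div_iff₀ (by positivity) (by norm_num)]
    nlinarith [mul_nonneg h0 hK, mul_nonneg (mul_nonneg h0 hK) hε.le, mul_nonneg h0 hε.le,
      mul_nonneg hK hε.le]
  have hrK : 2 * r * K ≤ ε / 3 := by
    rw [hr_def, mul_div_assoc', div_mul_eq_mul_div, div_le_div_iff₀ (by positivity) (by norm_num)]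
    nlinarith [mul_nonneg hK hε.le]
  calc ∑ σ ∈ I n, m n σ z (hMul z (0, 0, h))
      ≤ ∑ σ ∈ I n, (∑ d ∈ D, W n σ d + (2 * |s| * η + 2 * r) * (|(G n σ).1| + |(G n σ).2|)) :=
        Finset.sum_le_sum fun σ _ => hpt σ
    _ = ∑ d ∈ D, ∑ σ ∈ I n, W n σ d
        + (2 * |s| * η + 2 * r) * ∑ σ ∈ I n, (|(G n σ).1| + |(G n σ).2|) := by
        rw [Finset.sum_add_distrib, Finset.sum_comm, Finset.mul_sum]
    _ ≤ ε / 3 + (2 * |s| * η + 2 * r) * K := by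
        gcongr
        exact hGK n
    _ ≤ ε := by linarith

section Limit

variable {E : Type*} [NormedAddCommGroup E] [NormedSpace ℝ E] {F : SignFamily E} {f : Heis → E}
  {L : ℝ} {x : Heis} {G : ℕ → Finset ℕ → ℝ × ℝ} {N : Seminorm ℝ (ℝ × ℝ)}

lemma SignFamily.exists_tendsto_ultrafilter (F : SignFamily E)
    (hf : ∀ x y, ‖f x - f y‖ ≤ L * hDist x y) (x : Heis)
    (𝒰 : Ultrafilter ℝ) (h𝒰 : (𝒰 : Filter ℝ) ≤ 𝓝[>] 0) (n : ℕ) (σ : Finset ℕ) (a b : Heis) :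
    ∃ t, Tendsto (fun l : ℝ => l⁻¹ * F.M n σ (f (hMul x (dil l b)) - f (hMul x (dil l a))))
      𝒰 (𝓝 t) := by
  have hmem : ∀ᶠ l in (𝒰 : Filter ℝ),
      l⁻¹ * F.M n σ (f (hMul x (dil l b)) - f (hMul x (dil l a))) ∈ Icc 0 (L * hDist b a) := by
    filter_upwards [h𝒰 self_mem_nhdsWithin] with l hl
    have hl : 0 < l := hl
    refine ⟨mul_nonneg (inv_pos.2 hl).le (apply_nonneg _ _), ?_⟩
    exact (mul_le_mul_of_nonneg_left (F.M_le n σ _) (inv_pos.2 hl).le).trans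
      (inv_mul_norm_sub_le hf x hl b a)
  obtain ⟨t, -, ht⟩ := isCompact_Icc.ultrafilter_le_nhds (𝒰.map _) (le_principal_iff.2 hmem)
  exact ⟨t, ht⟩

lemma hMul_hExp_center (a b : Heis) : ∃ h : ℝ,
    b = hMul (hMul a (hExp (hPi b - hPi a))) (0, 0, h) := by
  refine ⟨b.2.2 - a.2.2 - (b.1 - a.1) * (b.2.1 - a.2.1) / 2 - a.1 * (b.2.1 - a.2.1), ?_⟩
  ext <;> simp [hMul, hExp, hPi]

/-- Rescalings along an ultrafilter converge to the seminorm of the projection. -/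
lemma SignFamily.IsBlowup.tendsto_ultrafilter (hB : F.IsBlowup f x G N)
    (hf : ∀ x y, ‖f x - f y‖ ≤ L * hDist x y)
    {𝒰 : Ultrafilter ℝ} (h𝒰 : (𝒰 : Filter ℝ) ≤ 𝓝[>] 0) (a b : Heis) :
    Tendsto (fun l : ℝ => l⁻¹ * ‖f (hMul x (dil l b)) - f (hMul x (dil l a))‖) 𝒰
      (𝓝 (N (hPi b - hPi a))) := by
  choose m hm using F.exists_tendsto_ultrafilter hf x 𝒰 h𝒰
  have hpos : ∀ᶠ l in (𝒰 : Filter ℝ), 0 < l := h𝒰 self_mem_nhdsWithin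
  have hsum : ∀ n a b, Tendsto
      (fun l : ℝ => l⁻¹ * ‖f (hMul x (dil l b)) - f (hMul x (dil l a))‖) 𝒰
      (𝓝 (∑ σ ∈ F.I n, m n σ a b)) := fun n a b => by
    simp only [← F.sum_M n, Finset.mul_sum]
    exact tendsto_finsetSum _ fun σ _ => hm n σ a b
  have htri : ∀ n σ a b c, m n σ a c ≤ m n σ a b + m n σ b c := fun n σ a b c => by
    refine le_of_tendsto_of_tendsto (hm n σ a c) ((hm n σ a b).add (hm n σ b c)) ?_
    filter_upwards [hpos] with l hl
    rw [← mul_add]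
    refine mul_le_mul_of_nonneg_left ?_ (inv_pos.2 hl).le
    rw [add_comm, ← sub_add_sub_cancel (f (hMul x (dil l c))) (f (hMul x (dil l b)))]
    exact map_add_le_add (F.M n σ) _ _
  have hge : ∀ n σ p (u : ℝ × ℝ),
      |u.1 * (G n σ).1 + u.2 * (G n σ).2| ≤ m n σ p (hMul p (hExp u)) := fun n σ p u => by
    refine le_of_tendsto_of_tendsto ((hB.tendsto n σ p u).mono_left h𝒰).abs (hm n σ p _) ?_
    filter_upwards [hpos] with l hl
    rw [abs_mul, abs_of_pos (inv_pos.2 hl)]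
    exact mul_le_mul_of_nonneg_left (F.abs_T_le n σ _) (inv_pos.2 hl).le
  have hle : ∀ n p u, ∑ σ ∈ F.I n, m n σ p (hMul p (hExp u)) ≤ N u := fun n p u => by
    refine le_of_forall_pos_le_add fun ε hε => le_of_tendsto (hsum n p _) ?_
    exact h𝒰 (hB.le_add p u ε hε)
  have hconst : ∀ n a b, ∑ σ ∈ F.I n, m n σ a b = ∑ σ ∈ F.I 0, m 0 σ a b := fun n a b =>
    tendsto_nhds_unique (hsum n a b) (hsum 0 a b)
  have hcenter : ∀ z h, ∑ σ ∈ F.I 0, m 0 σ z (hMul z (0, 0, h)) ≤ 0 := fun z h => by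
    refine le_of_forall_pos_le_add fun ε hε => ?_
    obtain ⟨n, hn⟩ := exists_sum_center_le htri hge hle hB.tendsto_sum z h hε
    rwa [zero_add, ← hconst n]
  have htri' : ∀ a b c, ∑ σ ∈ F.I 0, m 0 σ a c
      ≤ ∑ σ ∈ F.I 0, m 0 σ a b + ∑ σ ∈ F.I 0, m 0 σ b c := fun a b c => by
    rw [← Finset.sum_add_distrib]
    exact Finset.sum_le_sum fun σ _ => htri 0 σ a b c
  obtain ⟨h, hb⟩ := hMul_hExp_center a b
  set c := hMul a (hExp (hPi b - hPi a)) with hc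
  have hc' : c = hMul b (0, 0, -h) := by rw [hb]; simp [hMul]
  have h1 : ∑ σ ∈ F.I 0, m 0 σ c b ≤ 0 := by rw [hb]; exact hcenter c h
  have h2 : ∑ σ ∈ F.I 0, m 0 σ b c ≤ 0 := by rw [hc']; exact hcenter b (-h)
  have h3 : N (hPi b - hPi a) ≤ ∑ σ ∈ F.I 0, m 0 σ a c := le_of_tendsto' (hB.tendsto_sum _)
    fun n => (Finset.sum_le_sum fun σ _ => hge n σ a _).trans_eq (hconst n a _)
  have h4 : ∑ σ ∈ F.I 0, m 0 σ a c ≤ N (hPi b - hPi a) := hle 0 a _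
  have h5 : ∑ σ ∈ F.I 0, m 0 σ a b = N (hPi b - hPi a) := by
    linarith [htri' a c b, htri' a b c]
  rw [← h5]
  exact hsum 0 a b

lemma SignFamily.IsBlowup.tendsto_dist (hB : F.IsBlowup f x G N)
    (hf : ∀ x y, ‖f x - f y‖ ≤ L * hDist x y) (a b : Heis) :
    Tendsto (fun l : ℝ => (1 / l) * ‖f (hMul x (dil l a)) - f (hMul x (dil l b))‖) (𝓝[>] 0)
      (𝓝 (N (hPi a - hPi b))) := by
  simp only [one_div]
  exact (tendsto_iff_ultrafilter _ _ _).2 fun 𝒰 h𝒰 => hB.tendsto_ultrafilter hf h𝒰 b a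

lemma SignFamily.IsBlowup.tendstoLocallyUniformly (hB : F.IsBlowup f x G N)
    (hf : ∀ x y, ‖f x - f y‖ ≤ L * hDist x y) :
    TendstoLocallyUniformly
      (fun (l : ℝ) (z : Heis × Heis) =>
        (1 / l) * ‖f (hMul x (dil l z.1)) - f (hMul x (dil l z.2))‖)
      (fun z : Heis × Heis => N (hPi z.1 - hPi z.2)) (𝓝[>] 0) := by
  rw [Metric.tendstoLocallyUniformly_iff]
  intro ε hε p
  have hquot : ∀ l : ℝ, 0 < l → ∀ q : Heis × Heis,
      |(1 / l) * ‖f (hMul x (dil l q.1)) - f (hMul x (dil l q.2))‖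
        - (1 / l) * ‖f (hMul x (dil l p.1)) - f (hMul x (dil l p.2))‖|
        ≤ L * hDist q.1 p.1 + L * hDist q.2 p.2 := fun l hl q => by
    have h1 := inv_mul_norm_sub_le hf x hl q.1 p.1
    have h2 := inv_mul_norm_sub_le hf x hl q.2 p.2
    rw [one_div, ← mul_sub, abs_mul, abs_of_pos (inv_pos.2 hl)]
    refine le_trans ?_ (add_le_add h1 h2)
    rw [← mul_add]
    refine mul_le_mul_of_nonneg_left ((abs_norm_sub_norm_le _ _).trans ?_) (inv_pos.2 hl).le
    rw [sub_sub_sub_comm]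
    exact norm_sub_le _ _
  have hlim : ∀ q : Heis × Heis, |N (hPi q.1 - hPi q.2) - N (hPi p.1 - hPi p.2)|
      ≤ L * hDist q.1 p.1 + L * hDist q.2 p.2 := fun q => by
    refine le_of_tendsto ((hB.tendsto_dist hf q.1 q.2).sub (hB.tendsto_dist hf p.1 p.2)).abs ?_
    filter_upwards [self_mem_nhdsWithin] with l hl using hquot l hl q
  have hc : Continuous fun q : Heis × Heis => L * hDist q.1 p.1 + L * hDist q.2 p.2 :=
    ((continuous_hDist.comp (continuous_fst.prodMk continuous_const)).const_mul L).add
      ((continuous_hDist.comp (continuous_snd.prodMk continuous_const)).const_mul L)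
  refine ⟨{q | L * hDist q.1 p.1 + L * hDist q.2 p.2 < ε / 3},
    hc.continuousAt.eventually_lt continuousAt_const ?_, ?_⟩
  · simp only [hDist_self, mul_zero, add_zero]
    positivity
  filter_upwards [Metric.tendsto_nhds.1 (hB.tendsto_dist hf p.1 p.2) (ε / 3) (by positivity),
    self_mem_nhdsWithin] with l hl hl0 q (hq : _ < _)
  have h1 := abs_le.1 (hquot l hl0 q)
  have h2 := abs_le.1 (hlim q)
  rw [Real.dist_eq] at hl ⊢
  have h3 := abs_lt.1 hl
  rw [abs_lt]
  constructor <;> linarith [h1.1, h1.2, h2.1, h2.2, h3.1, h3.2]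

lemma SignFamily.IsBlowup.not_biLipschitz (hB : F.IsBlowup f x G N)
    (hf : ∀ x y, ‖f x - f y‖ ≤ L * hDist x y) {U : Set Heis} (hU : U ∈ 𝓝 x) {c : ℝ} (hc : 0 < c)
    (h : ∀ y ∈ U, ∀ z ∈ U, c * ccDist y z ≤ ‖f y - f z‖) : False := by
  have hx : ∀ l, hMul x (dil l 0) = x := fun l => by simp [hMul, dil]
  have hcont : Continuous fun l : ℝ => hMul x (dil l (0, 0, 1)) :=
    continuous_hMul.comp (continuous_const.prodMk
      (continuous_dil.comp (continuous_id.prodMk continuous_const)))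
  have ht := hcont.tendsto 0
  rw [show hMul x (dil 0 (0, 0, 1)) = x by simp [hMul, dil]] at ht
  have hlim := hB.tendsto_dist hf 0 (0, 0, 1)
  rw [show hPi 0 - hPi (0, 0, 1) = 0 by simp [hPi], map_zero] at hlim
  refine hc.not_ge (ge_of_tendsto hlim ?_)
  filter_upwards [self_mem_nhdsWithin, (ht.mono_left nhdsWithin_le_nhds) hU] with l hl hlU
  have hl : 0 < l := hl
  have h1 := h x (mem_of_mem_nhds hU) (hMul x (dil l (0, 0, 1))) hlU
  have h2 := sqrt_le_ccDist x (l ^ 2)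
  have h3 : dil l (0, 0, 1) = (0, 0, l ^ 2) := by simp [dil]
  rw [Real.sqrt_sq hl.le] at h2
  rw [hx, one_div, le_inv_mul_iff₀ hl, mul_comm]
  rw [h3] at h1 ⊢
  exact (mul_le_mul_of_nonneg_left h2 hc.le).trans h1

end Limit

/-- Metric differentiation for Lipschitz maps from the Heisenberg group to `L¹`:
for a.e. `x`, the rescaled pullback distances `ρ_{x,λ}` converge, uniformly on compact
subsets of `H × H`, to `(z₁,z₂) ↦ ‖π(z₁) - π(z₂)‖ₓ` for some seminorm `‖·‖ₓ` on `ℝ²`;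
in particular the limit vanishes along fibers of `π` and `f` is not bi-Lipschitz on any
neighborhood of `x`. -/
theorem statement0 {Y : Type*} [MeasurableSpace Y] (ν : Measure Y) [SigmaFinite ν]
    (f : Heis → Lp ℝ 1 ν) (C : ℝ)
    (hf : ∀ x y : Heis, ‖f x - f y‖ ≤ C * ccDist x y) :
    ∀ᵐ x ∂(volume : Measure Heis), ∃ N : Seminorm ℝ (ℝ × ℝ),
      (∀ K : Set (Heis × Heis), IsCompact K →
        TendstoUniformlyOn
          (fun lam (z : Heis × Heis) =>
            (1 / lam) * ‖f (hMul x (dil lam z.1)) - f (hMul x (dil lam z.2))‖)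
          (fun z : Heis × Heis => N (hPi z.1 - hPi z.2))
          (𝓝[>] (0 : ℝ)) K) ∧
      (∀ z₁ z₂ : Heis, hPi z₁ = hPi z₂ → N (hPi z₁ - hPi z₂) = 0) ∧
      (∀ U ∈ 𝓝 x, ¬ ∃ C' : ℝ, 1 ≤ C' ∧ ∀ y ∈ U, ∀ z ∈ U,
        (1 / C') * ccDist y z ≤ ‖f y - f z‖ ∧ ‖f y - f z‖ ≤ C' * ccDist y z) := by
  have hf' : ∀ x y, ‖f x - f y‖ ≤ |C| * 38 * hDist x y := fun x y =>
    calc ‖f x - f y‖ ≤ |C| * ccDist x y :=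
          (hf x y).trans (mul_le_mul_of_nonneg_right (le_abs_self C) (ccDist_nonneg x y))
      _ ≤ |C| * (38 * hDist x y) := mul_le_mul_of_nonneg_left (ccDist_le x y) (abs_nonneg C)
      _ = _ := by ring
  obtain ⟨F, hF⟩ := exists_signFamily_norming (continuous_of_hDist hf')
  filter_upwards [F.exists_isBlowup hf' (by positivity) hF] with x ⟨G, N, hB⟩
  refine ⟨N, fun K hK => ?_, fun z₁ z₂ h => by rw [h, sub_self, map_zero], ?_⟩
  · exact (tendstoLocallyUniformlyOn_iff_tendstoUniformlyOn_of_compact hK).1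
      (hB.tendstoLocallyUniformly hf').tendstoLocallyUniformlyOn
  · rintro U hU ⟨C', hC', h⟩
    exact hB.not_biLipschitz hf' hU (c := 1 / C') (by positivity) fun y hy z hz => (h y hy z hz).1
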